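/- Let m, n be positive integers with n ≥ 2m, and let B_1 ⊂ ℝ^n be the open unit ball. Let φ be the fundamental solution of (−Δ)^m in ℝ^n, namely φ(x) = c|x|^{2m−n} if n > 2m and φ(x) = c ln(5/|x|) if n = 2m, where c = c(m,n) > 0. Suppose u ∈ C^{2m}(B_1 \ {0}) solves (−Δ)^m u = f(x) in B_1 \ {0}, where f satisfies ∫_{B_1 \ {0}} |x|^s |f(x)| dx < ∞ for some integer 0 ≤ s ≤ 2m−1, and ∫_{B_1 \ {0}} u^+(x) dx < ∞ where u^+ = max{u, 0}. Define ψ(x,y) = φ(x−y) − Σ_{|β| ≤ s−1} ((−y)^β / β!) D^β φ(x) (the sum being empty when s = 0) and N(x) = ∫_{|y| ≤ 1} ψ(x,y) f(y) dy. Then there exist real constants a_β for each multi-index β with |β| ≤ 2m−1, and a function h ∈ C^∞(B_1) satisfying (−Δ)^m h = 0 in B_1, such that u(x) = N(x) + h(x) + Σ_{|β| ≤ 2m−1} a_β D^β φ(x) for all x ∈ B_1 \ {0}. -/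

import Mathlib

open MeasureTheory Metric Real Set
open scoped ENNReal NNReal

noncomputable section

/-- First-order partial derivative in direction `i`. -/
def pderiv1 {n : ℕ} (i : Fin n) (f : EuclideanSpace ℝ (Fin n) → ℝ) :
    EuclideanSpace ℝ (Fin n) → ℝ :=
  fun x => fderiv ℝ f x (EuclideanSpace.single i 1)

/-- The Laplacian `Δf = ∑ ∂²f/∂xᵢ²`. -/
def lap {n : ℕ} (f : EuclideanSpace ℝ (Fin n) → ℝ) : EuclideanSpace ℝ (Fin n) → ℝ :=
  fun x => ∑ i, pderiv1 i (pderiv1 i f) x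

/-- The negative Laplacian `-Δ`. -/
def nlap {n : ℕ} (f : EuclideanSpace ℝ (Fin n) → ℝ) : EuclideanSpace ℝ (Fin n) → ℝ :=
  fun x => -(lap f x)

/-- `(-Δ)^m`, the m-th iterate of the negative Laplacian. -/
def nlapIter {n : ℕ} (m : ℕ) (f : EuclideanSpace ℝ (Fin n) → ℝ) :
    EuclideanSpace ℝ (Fin n) → ℝ :=
  nlap^[m] f

/-- `D^β`, the mixed partial derivative associated to a multi-index `β`. -/
def mderiv {n : ℕ} (β : Fin n → ℕ) (f : EuclideanSpace ℝ (Fin n) → ℝ) :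
    EuclideanSpace ℝ (Fin n) → ℝ :=
  ((List.finRange n).foldr (fun i F => F ∘ (pderiv1 i)^[β i]) id) f

/-- The finset of multi-indices `β` with `|β| ≤ s`. -/
def degLE (n s : ℕ) : Finset (Fin n → ℕ) :=
  (Fintype.piFinset fun _ : Fin n => Finset.range (s+1)).filter fun β => ∑ i, β i ≤ s

/-- The finset of multi-indices `β` with `|β| < s` (i.e. `|β| ≤ s - 1`; empty for `s = 0`). -/
def degLT (n s : ℕ) : Finset (Fin n → ℕ) :=
  (Fintype.piFinset fun _ : Fin n => Finset.range s).filter fun β => ∑ i, β i < s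

/-- Fundamental-solution profile of `(-Δ)^m` on `ℝⁿ`:
`c‖x‖^{2m-n}` for `n > 2m` and `c ln(5/‖x‖)` for `n = 2m`. -/
def fundSol (m n : ℕ) (c : ℝ) : EuclideanSpace ℝ (Fin n) → ℝ :=
  fun x => if n = 2*m then c * Real.log (5 / ‖x‖) else c * ‖x‖ ^ ((2*m : ℤ) - n)

/-- `ψ(x,y) = φ(x-y) - ∑_{|β| ≤ s-1} ((-y)^β/β!) D^β φ(x)`. -/
def psiFun (m n s : ℕ) (c : ℝ) (x y : EuclideanSpace ℝ (Fin n)) : ℝ :=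
  fundSol m n c (x - y) -
    ∑ β ∈ degLT n s,
      ((∏ i, (-(y i)) ^ β i) / ∏ i, ((β i).factorial : ℝ)) * mderiv β (fundSol m n c) x

/-- `N(x) = ∫_{|y| ≤ 1} ψ(x,y) f(y) dy`. -/
def NFun (m n s : ℕ) (c : ℝ) (f : EuclideanSpace ℝ (Fin n) → ℝ)
    (x : EuclideanSpace ℝ (Fin n)) : ℝ :=
  ∫ y in closedBall (0 : EuclideanSpace ℝ (Fin n)) 1, psiFun m n s c x y * f y

section Basics

variable {n : ℕ}

local notation "E" => EuclideanSpace ℝ (Fin n)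

lemma pderiv1_congr {f g : E → ℝ} {x : E} (i : Fin n) (h : f =ᶠ[nhds x] g) :
    pderiv1 i f =ᶠ[nhds x] pderiv1 i g := by
  filter_upwards [h.fderiv (𝕜 := ℝ)] with y hy
  simp [pderiv1, hy]

lemma nlap_congr {f g : E → ℝ} {x : E} (h : f =ᶠ[nhds x] g) :
    nlap f =ᶠ[nhds x] nlap g := by
  have : ∀ᶠ y in nhds x, ∀ i, pderiv1 i (pderiv1 i f) y = pderiv1 i (pderiv1 i g) y :=
    Filter.eventually_all.2 fun i => pderiv1_congr i (pderiv1_congr i h)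
  filter_upwards [this] with y hy
  simp [nlap, lap, hy]

lemma nlapIter_succ (m : ℕ) (f : E → ℝ) : nlapIter (m + 1) f = nlapIter m (nlap f) := rfl

lemma nlapIter_succ' (m : ℕ) (f : E → ℝ) : nlapIter (m + 1) f = nlap (nlapIter m f) :=
  Function.iterate_succ_apply' _ _ _

lemma nlapIter_congr (m : ℕ) {f g : E → ℝ} {x : E} (h : f =ᶠ[nhds x] g) :
    nlapIter m f =ᶠ[nhds x] nlapIter m g := by
  induction m generalizing f g with
  | zero => exact h
  | succ m ih => exact ih (nlap_congr h)

lemma iterate_pderiv1_congr (i : Fin n) (k : ℕ) {f g : E → ℝ} {x : E} (h : f =ᶠ[nhds x] g) :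
    (pderiv1 i)^[k] f =ᶠ[nhds x] (pderiv1 i)^[k] g := by
  induction k generalizing f g with
  | zero => exact h
  | succ k ih => exact ih (pderiv1_congr i h)

/-- The mixed derivative along a list of coordinate directions with multiplicities `β`. -/
def listDeriv (β : Fin n → ℕ) (l : List (Fin n)) (f : E → ℝ) : E → ℝ :=
  (l.foldr (fun i F => F ∘ (pderiv1 i)^[β i]) id) f

lemma listDeriv_cons (β : Fin n → ℕ) (a : Fin n) (l : List (Fin n)) (f : E → ℝ) :
    listDeriv β (a :: l) f = listDeriv β l ((pderiv1 a)^[β a] f) := rfl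

lemma mderiv_eq_listDeriv (β : Fin n → ℕ) (f : E → ℝ) :
    mderiv β f = listDeriv β (List.finRange n) f := rfl

lemma listDeriv_congr (β : Fin n → ℕ) (l : List (Fin n)) {f g : E → ℝ} {x : E}
    (h : f =ᶠ[nhds x] g) : listDeriv β l f =ᶠ[nhds x] listDeriv β l g := by
  induction l generalizing f g with
  | nil => exact h
  | cons a l ih => exact ih (iterate_pderiv1_congr a _ h)

lemma mderiv_congr (β : Fin n → ℕ) {f g : E → ℝ} {x : E} (h : f =ᶠ[nhds x] g) :
    mderiv β f =ᶠ[nhds x] mderiv β g := listDeriv_congr β _ h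

lemma ContDiffOn.pderiv1 {k l : WithTop ℕ∞} {f : E → ℝ} {U : Set E} (hU : IsOpen U)
    (i : Fin n) (hf : ContDiffOn ℝ l f U) (hkl : k + 1 ≤ l) : ContDiffOn ℝ k (pderiv1 i f) U :=
  (hf.fderiv_of_isOpen hU hkl).clm_apply contDiffOn_const

lemma ContDiffOn.nlap {j k l : WithTop ℕ∞} {f : E → ℝ} {U : Set E} (hU : IsOpen U)
    (hf : ContDiffOn ℝ l f U) (hkl : k + 1 ≤ l) (hjk : j + 1 ≤ k) : ContDiffOn ℝ j (nlap f) U :=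
  (ContDiffOn.sum fun i _ => (hf.pderiv1 hU i hkl).pderiv1 hU i hjk).neg

lemma ContDiffOn.nlapIter {k m l : ℕ} {f : E → ℝ} {U : Set E} (hU : IsOpen U)
    (hf : ContDiffOn ℝ l f U) (hl : k + 2 * m ≤ l) : ContDiffOn ℝ k (nlapIter m f) U := by
  induction m generalizing f l with
  | zero => exact hf.of_le (by exact_mod_cast hl)
  | succ m ih =>
    refine ih (l := k + 2 * m) (hf.nlap (k := (k + 2 * m + 1 : ℕ)) hU ?_ ?_) le_rfl
    · exact_mod_cast (by omega : k + 2 * m + 1 + 1 ≤ l)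
    · exact_mod_cast le_rfl

lemma ContDiffOn.nlapIter_infty {m : ℕ} {f : E → ℝ} {U : Set E} (hU : IsOpen U)
    (hf : ContDiffOn ℝ (⊤ : ℕ∞) f U) : ContDiffOn ℝ (⊤ : ℕ∞) (_root_.nlapIter m f) U := by
  induction m generalizing f with
  | zero => exact hf
  | succ m ih => exact ih (hf.nlap (k := (⊤ : ℕ∞)) hU (by simp) (by simp))

lemma ContDiff.pderiv1 {k l : WithTop ℕ∞} {f : E → ℝ} (i : Fin n) (hf : ContDiff ℝ l f)
    (hkl : k + 1 ≤ l) : ContDiff ℝ k (pderiv1 i f) :=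
  contDiffOn_univ.1 (hf.contDiffOn.pderiv1 isOpen_univ i hkl)

lemma ContDiff.pderiv1_infty {f : E → ℝ} (i : Fin n) (hf : ContDiff ℝ (⊤ : ℕ∞) f) :
    ContDiff ℝ (⊤ : ℕ∞) (_root_.pderiv1 i f) := hf.pderiv1 i (by simp)

lemma ContDiff.nlapIter {k m l : ℕ} {f : E → ℝ} (hf : ContDiff ℝ l f) (hl : k + 2 * m ≤ l) :
    ContDiff ℝ k (nlapIter m f) :=
  contDiffOn_univ.1 (hf.contDiffOn.nlapIter isOpen_univ hl)

lemma ContDiff.continuous_nlapIter {m : ℕ} {f : E → ℝ} (hf : ContDiff ℝ (2 * m : ℕ) f) :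
    Continuous (_root_.nlapIter m f) :=
  (hf.nlapIter (k := 0) (m := m) (by omega)).continuous

lemma ContDiffOn.continuousOn_nlapIter {m : ℕ} {f : E → ℝ} {U : Set E} (hU : IsOpen U)
    (hf : ContDiffOn ℝ (2 * m : ℕ) f U) : ContinuousOn (_root_.nlapIter m f) U :=
  (hf.nlapIter (k := 0) (m := m) hU (by omega)).continuousOn

lemma pderiv1_zero (i : Fin n) : pderiv1 i (0 : E → ℝ) = 0 := by
  ext x; simp [pderiv1]

lemma nlapIter_zero_fun (m : ℕ) : nlapIter m (0 : E → ℝ) = 0 := by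
  induction m with
  | zero => rfl
  | succ m ih =>
    rw [nlapIter_succ']; ext x; simp [nlap, lap, ih, pderiv1_zero]

lemma nlapIter_eq_zero_of_eventuallyEq {m : ℕ} {f : E → ℝ} {x : E} (h : f =ᶠ[nhds x] 0) :
    nlapIter m f x = 0 := by
  rw [(nlapIter_congr m h).eq_of_nhds, nlapIter_zero_fun]; rfl

lemma tsupport_pderiv1_subset (i : Fin n) (f : E → ℝ) : tsupport (pderiv1 i f) ⊆ tsupport f :=
  tsupport_fderiv_apply_subset ℝ _

lemma tsupport_nlapIter_subset (m : ℕ) (f : E → ℝ) : tsupport (nlapIter m f) ⊆ tsupport f := by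
  refine closure_minimal (fun x hx => ?_) (isClosed_tsupport f)
  by_contra h
  exact hx (nlapIter_eq_zero_of_eventuallyEq (notMem_tsupport_iff_eventuallyEq.1 h))

lemma HasCompactSupport.nlapIter {f : E → ℝ} (m : ℕ) (hf : HasCompactSupport f) :
    HasCompactSupport (nlapIter m f) :=
  hf.mono' ((subset_tsupport _).trans (tsupport_nlapIter_subset m f))

lemma HasCompactSupport.pderiv1 {f : E → ℝ} (i : Fin n) (hf : HasCompactSupport f) :
    HasCompactSupport (pderiv1 i f) :=
  hf.mono' ((subset_tsupport _).trans (tsupport_pderiv1_subset i f))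

lemma pderiv1_comm {f : E → ℝ} (hf : ContDiff ℝ 2 f) (i j : Fin n) :
    pderiv1 i (pderiv1 j f) = pderiv1 j (pderiv1 i f) := by
  have hd : Differentiable ℝ (fderiv ℝ f) :=
    (hf.fderiv_right (m := 1) (by norm_num)).differentiable (by norm_num)
  have key : ∀ (i j : Fin n) (x : E), pderiv1 i (pderiv1 j f) x =
      fderiv ℝ (fderiv ℝ f) x (EuclideanSpace.single i 1) (EuclideanSpace.single j 1) := by
    intro i j x
    have : pderiv1 j f = fun y => fderiv ℝ f y (EuclideanSpace.single j 1) := rfl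
    rw [this, pderiv1, fderiv_clm_apply (hd x) (by fun_prop)]
    simp
  ext x
  rw [key, key]
  exact (hf.contDiffAt.isSymmSndFDerivAt (by simp)) _ _

lemma norm_iteratedFDeriv_pderiv1_le {f : E → ℝ} (hf : ContDiff ℝ (⊤ : ℕ∞) f) (i : Fin n)
    (j : ℕ) (x : E) :
    ‖iteratedFDeriv ℝ j (pderiv1 i f) x‖ ≤ ‖iteratedFDeriv ℝ (j + 1) f x‖ := by
  have h1 : ContDiff ℝ (⊤ : ℕ∞) (fderiv ℝ f) := hf.fderiv_right (by simp)
  have h := (ContinuousLinearMap.apply ℝ ℝ (EuclideanSpace.single i (1 : ℝ))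
    : (E →L[ℝ] ℝ) →L[ℝ] ℝ).norm_iteratedFDeriv_comp_left (x := x) (n := j) h1.contDiffAt
      (by exact_mod_cast le_top)
  rw [norm_iteratedFDeriv_fderiv] at h
  refine h.trans ?_
  have : ‖(ContinuousLinearMap.apply ℝ ℝ (EuclideanSpace.single i (1 : ℝ))
    : (E →L[ℝ] ℝ) →L[ℝ] ℝ)‖ ≤ 1 := by
    refine ContinuousLinearMap.opNorm_le_bound _ zero_le_one fun L => ?_
    have := L.le_opNorm (EuclideanSpace.single i (1 : ℝ))
    simpa using this
  simpa using mul_le_mul_of_nonneg_right this (norm_nonneg (iteratedFDeriv ℝ (j + 1) f x))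

lemma ContDiff.nlap_infty {f : E → ℝ} (hf : ContDiff ℝ (⊤ : ℕ∞) f) :
    ContDiff ℝ (⊤ : ℕ∞) (_root_.nlap f) :=
  contDiffOn_univ.1 (hf.contDiffOn.nlap (k := (⊤ : ℕ∞)) isOpen_univ (by simp) (by simp))

lemma norm_iteratedFDeriv_nlap_le {f : E → ℝ} (hf : ContDiff ℝ (⊤ : ℕ∞) f) (j : ℕ) (x : E) :
    ‖iteratedFDeriv ℝ j (nlap f) x‖ ≤ n * ‖iteratedFDeriv ℝ (j + 2) f x‖ := by
  have h1 : ∀ i : Fin n, ContDiff ℝ (⊤ : ℕ∞) (pderiv1 i (pderiv1 i f)) := fun i =>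
    (hf.pderiv1_infty i).pderiv1_infty i
  have : nlap f = fun x => -(∑ i, pderiv1 i (pderiv1 i f) x) := rfl
  rw [this]
  have e : iteratedFDeriv ℝ j (fun x => -(∑ i, pderiv1 i (pderiv1 i f) x)) x
      = -iteratedFDeriv ℝ j (fun x => ∑ i, pderiv1 i (pderiv1 i f) x) x :=
    iteratedFDeriv_neg_apply (f := fun x => ∑ i, pderiv1 i (pderiv1 i f) x)
  rw [e, norm_neg, iteratedFDeriv_fun_sum_apply
    (fun i _ => ((h1 i).of_le (by exact_mod_cast le_top)).contDiffAt)]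
  refine (norm_sum_le _ _).trans ?_
  calc _ ≤ ∑ i : Fin n, ‖iteratedFDeriv ℝ (j + 2) f x‖ := Finset.sum_le_sum fun i _ =>
        (norm_iteratedFDeriv_pderiv1_le (hf.pderiv1_infty i) i j x).trans
          (norm_iteratedFDeriv_pderiv1_le hf i (j + 1) x)
    _ = _ := by simp

lemma abs_nlapIter_le {f : E → ℝ} (hf : ContDiff ℝ (⊤ : ℕ∞) f) (m : ℕ) (x : E) :
    |nlapIter m f x| ≤ (n : ℝ) ^ m * ‖iteratedFDeriv ℝ (2 * m) f x‖ := by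
  induction m generalizing f with
  | zero => simp [nlapIter]
  | succ m ih =>
    rw [nlapIter_succ]
    refine (ih hf.nlap_infty).trans ?_
    rw [pow_succ, mul_assoc]
    exact mul_le_mul_of_nonneg_left (norm_iteratedFDeriv_nlap_le hf _ x) (by positivity)

end Basics

section IntegrationByParts

variable {n : ℕ}

local notation "E" => EuclideanSpace ℝ (Fin n)

lemma ContinuousOn.continuous_mul_of_tsupport_subset {f g : E → ℝ} {U : Set E} (hU : IsOpen U)
    (hf : ContinuousOn f U) (hg : Continuous g) (hgU : tsupport g ⊆ U) :
    Continuous fun x => f x * g x := by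
  refine continuous_of_tsupport fun x hx => ?_
  have hxU : x ∈ U := hgU (tsupport_mul_subset_right hx)
  exact (hf.continuousAt (hU.mem_nhds hxU)).mul hg.continuousAt

lemma HasCompactSupport.mul_of_or {f g : E → ℝ} (h : HasCompactSupport f ∨ HasCompactSupport g) :
    HasCompactSupport fun x => f x * g x :=
  h.elim (fun h => h.mul_right) fun h => h.mul_left

lemma integral_mul_pderiv1 {U : Set E} (hU : IsOpen U) {V ζ : E → ℝ}
    (hV : ContDiffOn ℝ 1 V U) (hζ : ContDiff ℝ 1 ζ) (hsupp : tsupport ζ ⊆ U)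
    (hc : HasCompactSupport V ∨ HasCompactSupport ζ) (i : Fin n) :
    ∫ x, V x * pderiv1 i ζ x = -∫ x, pderiv1 i V x * ζ x := by
  have hζ' : Continuous (pderiv1 i ζ) := (hζ.pderiv1 (k := 0) i (by norm_num)).continuous
  have hV' : ContinuousOn (pderiv1 i V) U := (hV.pderiv1 (k := 0) hU i (by norm_num)).continuousOn
  refine integral_mul_fderiv_eq_neg_fderiv_mul_of_integrable ?_ ?_ ?_ ?_ ?_
  · exact (hV'.continuous_mul_of_tsupport_subset hU hζ.continuous
      hsupp).integrable_of_hasCompactSupport (.mul_of_or (hc.imp_left fun h => h.pderiv1 i))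
  · exact (hV.continuousOn.continuous_mul_of_tsupport_subset hU hζ'
      ((tsupport_pderiv1_subset i ζ).trans hsupp)).integrable_of_hasCompactSupport
      (.mul_of_or (hc.imp_right fun h => h.pderiv1 i))
  · exact (hV.continuousOn.continuous_mul_of_tsupport_subset hU hζ.continuous
      hsupp).integrable_of_hasCompactSupport (.mul_of_or hc)
  · exact fun x hx => (hV.contDiffAt (hU.mem_nhds (hsupp hx))).differentiableAt (by norm_num)
  · exact fun x _ => hζ.differentiable (by norm_num) x

lemma integral_mul_nlap {U : Set E} (hU : IsOpen U) {V ζ : E → ℝ}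
    (hV : ContDiffOn ℝ 2 V U) (hζ : ContDiff ℝ 2 ζ) (hsupp : tsupport ζ ⊆ U)
    (hc : HasCompactSupport V ∨ HasCompactSupport ζ) :
    ∫ x, V x * nlap ζ x = ∫ x, nlap V x * ζ x := by
  have hζ' : ∀ i, ContDiff ℝ 1 (pderiv1 i ζ) := fun i => hζ.pderiv1 i (by norm_num)
  have hV' : ∀ i, ContDiffOn ℝ 1 (pderiv1 i V) U := fun i => hV.pderiv1 hU i (by norm_num)
  have hζ'' : ∀ i, Continuous (pderiv1 i (pderiv1 i ζ)) := fun i =>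
    ((hζ' i).pderiv1 (k := 0) i (by norm_num)).continuous
  have hV'' : ∀ i, ContinuousOn (pderiv1 i (pderiv1 i V)) U := fun i =>
    ((hV' i).pderiv1 (k := 0) hU i (by norm_num)).continuousOn
  have key : ∀ i, ∫ x, V x * pderiv1 i (pderiv1 i ζ) x = ∫ x, pderiv1 i (pderiv1 i V) x * ζ x := by
    intro i
    rw [integral_mul_pderiv1 hU (hV.of_le (by norm_num)) (hζ' i)
        ((tsupport_pderiv1_subset i ζ).trans hsupp) (hc.imp_right fun h => h.pderiv1 i),
      integral_mul_pderiv1 hU (hV' i) (hζ.of_le (by norm_num)) hsupp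
        (hc.imp_left fun h => h.pderiv1 i), neg_neg]
  simp only [nlap, lap, mul_neg, neg_mul, Finset.mul_sum, Finset.sum_mul, integral_neg]
  rw [integral_finsetSum, integral_finsetSum]
  · exact congrArg _ (Finset.sum_congr rfl fun i _ => key i)
  · intro i _
    exact ((hV'' i).continuous_mul_of_tsupport_subset hU hζ.continuous
      hsupp).integrable_of_hasCompactSupport
      (.mul_of_or (hc.imp_left fun h => (h.pderiv1 i).pderiv1 i))
  · intro i _
    exact (hV.continuousOn.continuous_mul_of_tsupport_subset hU (hζ'' i)
      (((tsupport_pderiv1_subset i _).trans (tsupport_pderiv1_subset i ζ)).trans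
        hsupp)).integrable_of_hasCompactSupport
      (.mul_of_or (hc.imp_right fun h => (h.pderiv1 i).pderiv1 i))

/-- Green's formula for `(-Δ)^m` without boundary terms. -/
lemma integral_mul_nlapIter {U : Set E} (hU : IsOpen U) (m : ℕ) {V ζ : E → ℝ}
    (hV : ContDiffOn ℝ (2 * m : ℕ) V U) (hζ : ContDiff ℝ (2 * m : ℕ) ζ) (hsupp : tsupport ζ ⊆ U)
    (hc : HasCompactSupport V ∨ HasCompactSupport ζ) :
    ∫ x, V x * nlapIter m ζ x = ∫ x, nlapIter m V x * ζ x := by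
  induction m generalizing V with
  | zero => rfl
  | succ m ih =>
    have h1 : ContDiff ℝ (2 : ℕ) (nlapIter m ζ) := hζ.nlapIter (by omega)
    have h2 : ContDiffOn ℝ (2 * m : ℕ) (nlap V) U :=
      hV.nlapIter (k := 2 * m) (m := 1) hU (by omega)
    rw [nlapIter_succ', integral_mul_nlap hU (hV.of_le (by exact_mod_cast (by omega))) h1
      ((tsupport_nlapIter_subset m ζ).trans hsupp) (hc.imp_right fun h => h.nlapIter m),
      ih h2 (hζ.of_le (by exact_mod_cast (by omega))) (hc.imp_left fun h => h.nlapIter 1)]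
    rfl

end IntegrationByParts

section FundamentalSolution

open scoped Convolution

variable {n : ℕ}

local notation "E" => EuclideanSpace ℝ (Fin n)

lemma contDiffOn_fundSol (m n : ℕ) (c : ℝ) :
    ContDiffOn ℝ (⊤ : ℕ∞) (fundSol m n c) ({0}ᶜ : Set (EuclideanSpace ℝ (Fin n))) := by
  intro x hx
  have hx0 : x ≠ 0 := hx
  have h1 : ContDiffAt ℝ (⊤ : ℕ∞) (fun y : EuclideanSpace ℝ (Fin n) => ‖y‖) x :=
    contDiffAt_norm ℝ hx0
  have h2 : ‖x‖ ≠ 0 := norm_ne_zero_iff.2 hx0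
  refine ContDiffAt.contDiffWithinAt ?_
  unfold fundSol
  split_ifs
  · exact contDiffAt_const.mul ((contDiffAt_const.div h1 h2).log (div_ne_zero (by norm_num) h2))
  · generalize (2 * (m : ℤ) - n) = k
    refine contDiffAt_const.mul ?_
    cases k with
    | ofNat k => simpa using h1.pow k
    | negSucc k =>
      simp only [zpow_negSucc]
      exact (h1.pow (k + 1)).inv (pow_ne_zero _ h2)

lemma locallyIntegrable_fundSol {m : ℕ} (hm : 0 < m) (hn : 2 * m ≤ n) (c : ℝ) :
    LocallyIntegrable (fundSol m n c) (volume : Measure E) := by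
  have : Nonempty (Fin n) := ⟨⟨0, by omega⟩⟩
  rw [locallyIntegrable_iff]
  intro K hK
  obtain ⟨R, hR⟩ := hK.isBounded.subset_ball (0 : E)
  refine IntegrableOn.mono_set ?_ hR
  have hF : fundSol m n c = fun x : E =>
      (fun r : ℝ => if n = 2*m then c * Real.log (5 / r) else c * r ^ ((2*m : ℤ) - n)) ‖x‖ := rfl
  rw [hF, integrableOn_fun_norm_addHaar (volume : Measure E) (f := fun r : ℝ =>
    if n = 2*m then c * Real.log (5 / r) else c * r ^ ((2*m : ℤ) - n))]
  rw [finrank_euclideanSpace_fin]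
  have hcont : Continuous fun y : ℝ => if n = 2 * m then
      c * (y ^ (n - 1) * Real.log 5 - y ^ (n - 2) * (y * Real.log y)) else c * y ^ (2 * m - 1) := by
    split_ifs
    · have := Real.continuous_mul_log
      fun_prop
    · fun_prop
  refine ((hcont.continuousOn.integrableOn_compact (isCompact_Icc (a := 0) (b := R))).mono_set
    Ioo_subset_Icc_self).congr_fun (fun y hy => ?_) measurableSet_Ioo
  have hy0 : y ≠ 0 := hy.1.ne'
  simp only [smul_eq_mul]
  split_ifs
  · rw [Real.log_div (by norm_num) hy0]
    have : y ^ (n - 1) = y ^ (n - 2) * y := by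
      rw [← pow_succ]; congr 1; omega
    rw [this]; ring
  · have : y ^ (2 * m - 1) = y ^ (n - 1) * y ^ ((2*m : ℤ) - n) := by
      rw [← zpow_natCast, ← zpow_natCast, ← zpow_add₀ hy0]
      congr 1
      push_cast [Nat.cast_sub (show 1 ≤ 2 * m by omega), Nat.cast_sub (show 1 ≤ n by omega)]
      ring
    rw [this]; ring

lemma MeasureTheory.LocallyIntegrable.comp_const_sub {φ : E → ℝ} (hφ : LocallyIntegrable φ volume)
    (x : E) : LocallyIntegrable (fun y => φ (x - y)) volume := by
  rw [locallyIntegrable_iff]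
  intro K hK
  obtain ⟨R, hR⟩ := hK.isBounded.subset_closedBall x
  have h := ((Measure.measurePreserving_sub_left (volume : Measure E) x).integrableOn_comp_preimage
    (MeasurableEquiv.subLeft x).measurableEmbedding (s := closedBall 0 R)).2
    (hφ.integrableOn_isCompact (isCompact_closedBall _ _))
  refine h.mono_set fun y hy => ?_
  have := hR hy
  simp only [mem_closedBall, dist_eq_norm, mem_preimage, sub_zero] at this ⊢
  rwa [norm_sub_rev]

lemma integrable_comp_sub_mul {φ h : E → ℝ} (hφ : LocallyIntegrable φ volume) (hh : Continuous h)
    (hc : HasCompactSupport h) (x : E) : Integrable fun y => φ (x - y) * h y :=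
  (hφ.comp_const_sub x).integrable_smul_right_of_hasCompactSupport hh hc

lemma pderiv1_convolution {f g : E → ℝ} (hf : LocallyIntegrable f volume)
    (hg : ContDiff ℝ 1 g) (hc : HasCompactSupport g) (i : Fin n) :
    pderiv1 i (f ⋆[ContinuousLinearMap.lsmul ℝ ℝ, volume] g) =
      f ⋆[ContinuousLinearMap.lsmul ℝ ℝ, volume] (pderiv1 i g) := by
  ext x
  rw [pderiv1, (hc.hasFDerivAt_convolution_right _ hf hg x).fderiv,
    convolution_precompR_apply _ hf (hc.fderiv ℝ) (hg.continuous_fderiv one_ne_zero)]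
  rfl

lemma nlap_convolution {f g : E → ℝ} (hf : LocallyIntegrable f volume)
    (hg : ContDiff ℝ 2 g) (hc : HasCompactSupport g) :
    nlap (f ⋆[ContinuousLinearMap.lsmul ℝ ℝ, volume] g) =
      f ⋆[ContinuousLinearMap.lsmul ℝ ℝ, volume] (nlap g) := by
  have h1 : ∀ i, ContDiff ℝ 1 (pderiv1 i g) := fun i => hg.pderiv1 i (by norm_num)
  ext x
  simp only [nlap, lap]
  have : ∀ i, pderiv1 i (pderiv1 i (f ⋆[ContinuousLinearMap.lsmul ℝ ℝ, volume] g)) =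
      f ⋆[ContinuousLinearMap.lsmul ℝ ℝ, volume] (pderiv1 i (pderiv1 i g)) := fun i => by
    rw [pderiv1_convolution hf (hg.of_le (by norm_num)) hc,
      pderiv1_convolution hf (h1 i) (hc.pderiv1 i)]
  simp only [this, convolution_def]
  rw [← integral_finsetSum, ← integral_neg]
  · refine integral_congr_ae (.of_forall fun t => ?_)
    simp [nlap, lap, Finset.mul_sum]
  · intro i _
    exact ((hc.pderiv1 i).pderiv1 i).convolutionExists_right _ hf
      (((h1 i).pderiv1 (k := 0) i (by norm_num)).continuous) x

lemma nlapIter_convolution {f g : E → ℝ} (m : ℕ) (hf : LocallyIntegrable f volume)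
    (hg : ContDiff ℝ (2 * m : ℕ) g) (hc : HasCompactSupport g) :
    nlapIter m (f ⋆[ContinuousLinearMap.lsmul ℝ ℝ, volume] g) =
      f ⋆[ContinuousLinearMap.lsmul ℝ ℝ, volume] (nlapIter m g) := by
  induction m generalizing g with
  | zero => rfl
  | succ m ih =>
    rw [nlapIter_succ, nlap_convolution hf (hg.of_le (by exact_mod_cast (by omega))) hc,
      ih (g := nlap g) (hg.nlapIter (m := 1) (by omega)) (hc.nlapIter 1)]
    rfl

/-- `c` is such that `fundSol m n c` is a fundamental solution of `(-Δ)^m`. -/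
def IsFundConst (m n : ℕ) (c : ℝ) : Prop :=
  ∀ η : EuclideanSpace ℝ (Fin n) → ℝ, ContDiff ℝ (⊤ : ℕ∞) η →
      HasCompactSupport η → ∫ x, fundSol m n c x * nlapIter m η x = η 0

lemma nlapIter_comp_const_sub (m : ℕ) (f : E → ℝ) (x z : E) :
    nlapIter m (fun y => f (x - y)) z = nlapIter m f (x - z) := by
  have h1 : ∀ (i : Fin n) (f : E → ℝ),
      pderiv1 i (fun y => f (x - y)) = fun y => -pderiv1 i f (x - y) := by
    intro i f
    ext y
    have h : (fun y => f (x - y)) = fun y => (fun z => f (x + z)) ((-1 : ℝ) • y) := by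
      simp [sub_eq_add_neg]
    rw [pderiv1, h, fderiv_comp_smul (f := fun z => f (x + z)), fderiv_comp_add_left]
    simp [pderiv1, sub_eq_add_neg]
  have h1' : ∀ (i : Fin n) (f : E → ℝ), pderiv1 i (fun y => -f y) = fun y => -pderiv1 i f y := by
    intro i f
    ext y
    simp [pderiv1, fderiv_fun_neg]
  have h2 : ∀ f : E → ℝ, nlap (fun y => f (x - y)) = fun y => nlap f (x - y) := by
    intro f
    ext y
    simp [nlap, lap, h1, h1']
  have : nlapIter m (fun y => f (x - y)) = fun y => nlapIter m f (x - y) := by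
    induction m generalizing f with
    | zero => rfl
    | succ m ih => rw [nlapIter_succ, h2, ih]; rfl
  rw [this]

lemma IsFundConst.integral_smooth {m : ℕ} {c : ℝ} (hc : IsFundConst m n c) {V : E → ℝ}
    (hV : ContDiff ℝ (⊤ : ℕ∞) V) (hcomp : HasCompactSupport V) (x : E) :
    ∫ y, fundSol m n c (x - y) * nlapIter m V y = V x := by
  have h := hc (fun y => V (x - y)) (hV.comp (contDiff_const.sub contDiff_id))
    (hcomp.comp_homeomorph (Homeomorph.subLeft x))
  simp only [sub_zero] at h
  rw [← h, ← integral_sub_left_eq_self _ volume x]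
  refine integral_congr_ae (.of_forall fun z => ?_)
  simp only [nlapIter_comp_const_sub, sub_sub_self]

/-- The representation formula for compactly supported functions of finite regularity. -/
lemma IsFundConst.integral_eq {m : ℕ} {c : ℝ} (hc : IsFundConst m n c) (hm : 0 < m)
    (hn : 2 * m ≤ n) {V : E → ℝ} (hV : ContDiff ℝ (2 * m : ℕ) V) (hcomp : HasCompactSupport V)
    (x : E) : ∫ y, fundSol m n c (x - y) * nlapIter m V y = V x := by
  have hφ := locallyIntegrable_fundSol hm hn c
  set v := nlapIter m V with hv
  have hvc : Continuous v := hV.continuous_nlapIter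
  have hvs : HasCompactSupport v := hcomp.nlapIter m
  obtain ⟨R, hR⟩ := hvs.isCompact.isBounded.subset_closedBall (0 : E)
  set C := ∫ y in closedBall (0 : E) (R + 1), |fundSol m n c (x - y)| with hC
  have hC0 : 0 ≤ C := integral_nonneg fun _ => abs_nonneg _
  have hφi : IntegrableOn (fun y => |fundSol m n c (x - y)|) (closedBall (0 : E) (R + 1)) :=
    ((hφ.comp_const_sub x).integrableOn_isCompact (isCompact_closedBall _ _)).abs
  have key : ∀ ε > 0, dist (∫ y, fundSol m n c (x - y) * v y) (V x) ≤ (C + 1) * ε := by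
    intro ε hε
    obtain ⟨δ₁, hδ₁, h₁⟩ := Metric.uniformContinuous_iff.1
      (hvs.uniformContinuous_of_continuous hvc) ε hε
    obtain ⟨δ₂, hδ₂, h₂⟩ := Metric.continuousAt_iff.1 (hV.continuous.continuousAt (x := x)) ε hε
    set δ := min 1 (min δ₁ δ₂)
    have hδ : 0 < δ := by positivity
    let b : ContDiffBump (0 : E) := ⟨δ / 2, δ, by positivity, by linarith⟩
    have hbV : ContDiff ℝ (⊤ : ℕ∞) (b.normed volume ⋆[ContinuousLinearMap.lsmul ℝ ℝ, volume] V) :=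
      b.hasCompactSupport_normed.contDiff_convolution_left _ b.contDiff_normed
        hV.continuous.locallyIntegrable
    have hbVc := b.hasCompactSupport_normed.convolution (μ := volume)
      (ContinuousLinearMap.lsmul ℝ ℝ) hcomp (f := b.normed volume)
    have hbi : LocallyIntegrable (b.normed (volume : Measure E)) volume :=
      b.continuous_normed.locallyIntegrable
    have hrep := hc.integral_smooth hbV hbVc x
    rw [nlapIter_convolution m hbi hV hcomp, ← hv] at hrep
    set w := b.normed volume ⋆[ContinuousLinearMap.lsmul ℝ ℝ, volume] v with hw
    have hwc : Continuous w :=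
      hvs.continuous_convolution_right _ hbi hvc
    have hws : HasCompactSupport w := b.hasCompactSupport_normed.convolution _ hvs
    have hd : ∀ y, dist (w y) (v y) ≤ ε := fun y =>
      b.dist_normed_convolution_le hvc.aestronglyMeasurable fun z hz =>
        (h₁ ((mem_ball.1 hz).trans_le ((min_le_right _ _).trans (min_le_left _ _)))).le
    have hz : ∀ y ∉ closedBall (0 : E) (R + 1), w y = 0 ∧ v y = 0 := by
      intro y hy
      have h0 : ∀ z ∈ ball y b.rOut, v z = 0 := by
        intro z hz
        by_contra hne
        have h3 := hR (subset_tsupport _ hne)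
        have h4 : dist z y < 1 := (mem_ball.1 hz).trans_le (min_le_left _ _)
        rw [mem_closedBall] at h3 hy
        have := dist_triangle y z 0
        rw [dist_comm y z] at this
        linarith
      have hv0 : v y = 0 := h0 y (mem_ball_self hδ)
      have := b.dist_normed_convolution_le (x₀ := y) (ε := 0) hvc.aestronglyMeasurable
        (μ := volume) fun z hz => by rw [h0 z hz, hv0, dist_self]
      exact ⟨by rw [← hv0]; exact dist_le_zero.1 this, hv0⟩
    have hVd : dist ((b.normed volume ⋆[ContinuousLinearMap.lsmul ℝ ℝ, volume] V) x) (V x) ≤ ε :=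
      b.dist_normed_convolution_le hV.continuous.aestronglyMeasurable fun z hz =>
        (h₂ ((mem_ball.1 hz).trans_le ((min_le_right _ _).trans (min_le_right _ _)))).le
    rw [← hrep] at hVd
    have hd2 : dist (∫ y, fundSol m n c (x - y) * v y) (∫ y, fundSol m n c (x - y) * w y)
        ≤ C * ε := by
      rw [dist_eq_norm, ← integral_sub (integrable_comp_sub_mul hφ hvc hvs x)
        (integrable_comp_sub_mul hφ hwc hws x)]
      have e : ∀ y, fundSol m n c (x - y) * v y - fundSol m n c (x - y) * w y =
          (closedBall (0 : E) (R + 1)).indicator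
            (fun y => fundSol m n c (x - y) * (v y - w y)) y := by
        intro y
        by_cases hy : y ∈ closedBall (0 : E) (R + 1)
        · simp [indicator_of_mem hy, mul_sub]
        · simp [indicator_of_notMem hy, (hz y hy).1, (hz y hy).2]
      simp_rw [e]
      rw [integral_indicator measurableSet_closedBall, hC, ← integral_mul_const]
      refine norm_integral_le_of_norm_le (hφi.mul_const ε) (.of_forall fun y => ?_)
      rw [norm_mul, Real.norm_eq_abs]
      refine mul_le_mul_of_nonneg_left ?_ (abs_nonneg _)
      rw [← dist_eq_norm, dist_comm]
      exact hd y
    calc _ ≤ _ := dist_triangle _ (∫ y, fundSol m n c (x - y) * w y) _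
      _ ≤ C * ε + ε := add_le_add hd2 hVd
      _ = _ := by ring
  refine dist_le_zero.1 (le_of_forall_pos_le_add fun ε hε => ?_)
  have := key (ε / (C + 1)) (by positivity)
  rw [mul_div_cancel₀ _ (by positivity)] at this
  linarith

lemma IsFundConst.nlapIter_fundSol {m : ℕ} {c : ℝ} (hc : IsFundConst m n c) {x : E}
    (hx : x ≠ 0) : nlapIter m (fundSol m n c) x = 0 := by
  have hU : IsOpen ({0}ᶜ : Set E) := isOpen_compl_singleton
  have hsm := contDiffOn_fundSol m n c
  have hcont : ContinuousOn (nlapIter m (fundSol m n c)) ({0}ᶜ : Set E) :=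
    (hsm.nlapIter_infty hU).continuousOn
  have hae := hU.ae_eq_zero_of_integral_contDiff_smul_eq_zero (μ := volume)
    (f := nlapIter m (fundSol m n c)) (hcont.locallyIntegrableOn hU.measurableSet)
    (fun g hg hgc hgs => by
      have h1 := integral_mul_nlapIter hU m (V := fundSol m n c) (ζ := g)
        (contDiffOn_infty.1 hsm _) (contDiff_infty.1 hg _) hgs (.inr hgc)
      rw [hc g hg hgc] at h1
      have h0 : g 0 = 0 := by
        by_contra h
        exact hgs (subset_tsupport _ h) rfl
      rw [h0] at h1
      rw [h1]
      exact integral_congr_ae (.of_forall fun y => by simp [mul_comm]))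
  have := Measure.eqOn_open_of_ae_eq (μ := volume) (U := ({0}ᶜ : Set E))
    (f := nlapIter m (fundSol m n c)) (g := fun _ => 0)
    ((ae_restrict_iff' hU.measurableSet).2 hae) hU hcont continuousOn_const
  exact this hx

end FundamentalSolution

section RadialTestFunction

open Polynomial in
/-- The operator `a - X ∂` on polynomials. -/
def eulerOp (a : ℝ) (q : Polynomial ℝ) : Polynomial ℝ := C a * q - X * derivative q

open Polynomial in
lemma coeff_eulerOp (a : ℝ) (q : Polynomial ℝ) (i : ℕ) :
    (eulerOp a q).coeff i = (a - i) * q.coeff i := by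
  cases i with
  | zero => simp [eulerOp]
  | succ i =>
    simp only [eulerOp, coeff_sub, coeff_C_mul, coeff_X_mul, coeff_derivative]
    push_cast
    ring

lemma eulerOp_add (a : ℝ) (p q : Polynomial ℝ) : eulerOp a (p + q) = eulerOp a p + eulerOp a q := by
  ext i
  simp only [coeff_eulerOp, Polynomial.coeff_add]
  ring

/-- Successive application of `a₀ - X ∂`, …, `a_{k-1} - X ∂`. -/
def eulerIter (a : ℕ → ℝ) : ℕ → Polynomial ℝ → Polynomial ℝ
  | 0, q => q
  | k + 1, q => eulerOp (a k) (eulerIter a k q)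

lemma coeff_eulerIter (a : ℕ → ℝ) (k : ℕ) (q : Polynomial ℝ) (i : ℕ) :
    (eulerIter a k q).coeff i = (∏ j ∈ Finset.range k, (a j - i)) * q.coeff i := by
  induction k with
  | zero => simp [eulerIter]
  | succ k ih => rw [eulerIter, coeff_eulerOp, ih, Finset.prod_range_succ]; ring

open Polynomial in
/-- The cone generated by `X^l (1 - X)^(N - l)`, `l ≤ j`. -/
def bernsteinCone (N j : ℕ) : AddSubmonoid (Polynomial ℝ) :=
  AddSubmonoid.closure {p | ∃ b : ℝ, 0 ≤ b ∧ ∃ l ≤ j, p = C b * (X ^ l * (1 - X) ^ (N - l))}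

open Polynomial in
lemma eulerOp_mem_bernsteinCone {N j : ℕ} (hj : j < N) {a : ℝ} (ha : j ≤ a) {q : Polynomial ℝ}
    (hq : q ∈ bernsteinCone N j) : eulerOp a q ∈ bernsteinCone N (j + 1) := by
  induction hq using AddSubmonoid.closure_induction with
  | mem p hp =>
    obtain ⟨b, hb, l, hl, rfl⟩ := hp
    obtain ⟨k, rfl⟩ : ∃ k, N = l + (k + 1) := ⟨N - l - 1, by omega⟩
    have hXl : X * derivative (X ^ l : Polynomial ℝ) = C (l : ℝ) * X ^ l := by
      cases l with
      | zero => simp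
      | succ l => simp only [derivative_X_pow, Nat.add_sub_cancel]; ring
    have h1 : derivative ((1 - X) ^ (k + 1) : Polynomial ℝ) =
        -(C ((k + 1 : ℕ) : ℝ) * (1 - X) ^ k) := by
      rw [derivative_pow]
      simp
    have key : eulerOp a (C b * (X ^ l * (1 - X) ^ (l + (k + 1) - l))) =
        C (b * (a - l)) * (X ^ l * (1 - X) ^ (l + (k + 1) - l)) +
        C (b * (k + 1 : ℕ)) * (X ^ (l + 1) * (1 - X) ^ (l + (k + 1) - (l + 1))) := by
      have e1 : l + (k + 1) - l = k + 1 := by omega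
      have e2 : l + (k + 1) - (l + 1) = k := by omega
      rw [e1, e2, eulerOp, derivative_C_mul, derivative_mul, h1, C_mul, C_mul, C_sub]
      linear_combination (-(C b) * (1 - X) ^ (k + 1)) * hXl
    have hl' : (l : ℝ) ≤ j := by exact_mod_cast hl
    rw [key]
    exact add_mem (AddSubmonoid.subset_closure ⟨_, mul_nonneg hb (by linarith), l, by omega, rfl⟩)
      (AddSubmonoid.subset_closure ⟨_, mul_nonneg hb (by positivity), l + 1, by omega, rfl⟩)
  | zero => simp [eulerOp]
  | add p q _ _ hp hq => rw [eulerOp_add]; exact add_mem hp hq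

open Polynomial in
lemma eulerIter_mem_bernsteinCone {N : ℕ} {a : ℕ → ℝ} (ha : ∀ j, j ≤ a j) (j : ℕ) (hj : j ≤ N) :
    eulerIter a j ((1 - X) ^ N) ∈ bernsteinCone N j := by
  induction j with
  | zero => exact AddSubmonoid.subset_closure ⟨1, zero_le_one, 0, le_rfl, by simp [eulerIter]⟩
  | succ j ih => exact eulerOp_mem_bernsteinCone (by omega) (ha j) (ih (by omega))

lemma eval_nonneg_of_mem_bernsteinCone {N j : ℕ} {q : Polynomial ℝ} (hq : q ∈ bernsteinCone N j)
    {τ : ℝ} (h0 : 0 ≤ τ) (h1 : τ ≤ 1) : 0 ≤ q.eval τ := by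
  induction hq using AddSubmonoid.closure_induction with
  | mem p hp =>
    obtain ⟨b, hb, l, hl, rfl⟩ := hp
    have : 0 ≤ 1 - τ := by linarith
    simp only [Polynomial.eval_mul, Polynomial.eval_C, Polynomial.eval_pow, Polynomial.eval_X,
      Polynomial.eval_sub, Polynomial.eval_one]
    positivity
  | zero => simp
  | add p q _ _ hp hq => rw [Polynomial.eval_add]; exact add_nonneg hp hq

lemma hasDerivAt_pow_mul_eval (k : ℕ) (q : Polynomial ℝ) (ρ : ℝ) {t : ℝ} (ht : t ≠ 0) :
    HasDerivAt (fun t => t ^ k * q.eval (ρ / t)) (t ^ k * (eulerOp k q).eval (ρ / t) / t) t := by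
  have h1 : HasDerivAt (fun t : ℝ => ρ / t) (-ρ / t ^ 2) t := by
    exact ((hasDerivAt_inv ht).const_mul ρ).congr_deriv (by field_simp)
  have h2 : HasDerivAt (fun t => t ^ k * q.eval (ρ / t)) _ t :=
    (hasDerivAt_pow k t).mul ((q.hasDerivAt (ρ / t)).comp t h1)
  refine h2.congr_deriv ?_
  simp only [eulerOp, Polynomial.eval_sub, Polynomial.eval_mul, Polynomial.eval_C,
    Polynomial.eval_X]
  cases k with
  | zero => simp; field_simp
  | succ k => simp only [Nat.add_sub_cancel]; push_cast; field_simp; ring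

variable {n : ℕ}

local notation "E" => EuclideanSpace ℝ (Fin n)

lemma hasFDerivAt_comp_normSq {g : ℝ → ℝ} {g' : ℝ} {z : E} (hg : HasDerivAt g g' (‖z‖ ^ 2)) :
    HasFDerivAt (fun y : E => g (‖y‖ ^ 2)) (g' • ((2 : ℝ) • innerSL ℝ z)) z := by
  refine hg.comp_hasFDerivAt z ?_
  have := (hasStrictFDerivAt_norm_sq z).hasFDerivAt
  rwa [← Nat.cast_smul_eq_nsmul ℝ] at this

lemma pderiv1_comp_normSq {g : ℝ → ℝ} {g' : ℝ} {z : E} (hg : HasDerivAt g g' (‖z‖ ^ 2))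
    (i : Fin n) : pderiv1 i (fun y : E => g (‖y‖ ^ 2)) z = 2 * z i * g' := by
  rw [pderiv1, (hasFDerivAt_comp_normSq hg).fderiv]
  simp [EuclideanSpace.inner_single_right]
  ring

lemma nlap_comp_normSq {g g₁ : ℝ → ℝ} {g₂ : ℝ} {z : E}
    (hg : ∀ᶠ t in nhds (‖z‖ ^ 2), HasDerivAt g (g₁ t) t) (hg₁ : HasDerivAt g₁ g₂ (‖z‖ ^ 2)) :
    nlap (fun y : E => g (‖y‖ ^ 2)) z = -(2 * n * g₁ (‖z‖ ^ 2) + 4 * ‖z‖ ^ 2 * g₂) := by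
  have hcont : Filter.Tendsto (fun y : E => ‖y‖ ^ 2) (nhds z) (nhds (‖z‖ ^ 2)) :=
    (continuous_norm.pow 2).continuousAt
  have h1 : ∀ i, pderiv1 i (fun y : E => g (‖y‖ ^ 2)) =ᶠ[nhds z]
      fun y => 2 * y i * g₁ (‖y‖ ^ 2) := fun i => by
    filter_upwards [hcont.eventually hg] with y hy using pderiv1_comp_normSq hy i
  have h2 : ∀ i, pderiv1 i (pderiv1 i (fun y : E => g (‖y‖ ^ 2))) z =
      2 * g₁ (‖z‖ ^ 2) + 4 * z i ^ 2 * g₂ := by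
    intro i
    rw [(pderiv1_congr i (h1 i)).eq_of_nhds, pderiv1]
    have hi : HasFDerivAt (fun y : E => 2 * y i)
        ((2 : ℝ) • (EuclideanSpace.proj i : E →L[ℝ] ℝ)) z :=
      ((EuclideanSpace.proj i : E →L[ℝ] ℝ).hasFDerivAt).const_mul 2
    have := (hi.mul (hasFDerivAt_comp_normSq hg₁)).fderiv
    rw [show (fun y : E => 2 * y i * g₁ (‖y‖ ^ 2)) =
      (fun y : E => 2 * y i) * fun y : E => g₁ (‖y‖ ^ 2) from rfl, this]
    simp [EuclideanSpace.inner_single_right]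
    ring
  simp only [nlap, lap, h2, Finset.sum_add_distrib, ← Finset.sum_mul, ← Finset.mul_sum]
  simp only [EuclideanSpace.norm_sq_eq z, Finset.sum_const, Finset.card_univ, Fintype.card_fin,
    nsmul_eq_mul, Real.norm_eq_abs, sq_abs]
  ring

/-- The polynomial profile of `(-Δ)^k (|y|^(2k) q(ρ / |y|²))`, up to the factor `(-4)^k`. -/
def lapProfile (n : ℕ) : ℕ → Polynomial ℝ → Polynomial ℝ
  | 0, q => q
  | k + 1, q => lapProfile n k (eulerOp (k + n / 2) (eulerOp (k + 1) q))

lemma nlapIter_pow_mul_eval (k : ℕ) (q : Polynomial ℝ) (ρ : ℝ) {z : E} (hz : z ≠ 0) :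
    nlapIter k (fun y : E => (‖y‖ ^ 2) ^ k * q.eval (ρ / ‖y‖ ^ 2)) z =
      (-4) ^ k * (lapProfile n k q).eval (ρ / ‖z‖ ^ 2) := by
  induction k generalizing q z with
  | zero => simp [nlapIter, lapProfile]
  | succ k ih =>
    have h1 : ∀ y : E, y ≠ 0 →
        nlap (fun y : E => (‖y‖ ^ 2) ^ (k + 1) * q.eval (ρ / ‖y‖ ^ 2)) y = (-4) *
          ((‖y‖ ^ 2) ^ k * (eulerOp (k + n / 2) (eulerOp (k + 1) q)).eval (ρ / ‖y‖ ^ 2)) := by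
      intro y hy
      have hy2 : ‖y‖ ^ 2 ≠ 0 := pow_ne_zero _ (norm_ne_zero_iff.2 hy)
      rw [nlap_comp_normSq (g := fun t => t ^ (k + 1) * q.eval (ρ / t))
        (g₁ := fun t => t ^ k * (eulerOp (k + 1) q).eval (ρ / t)) ?_
        (hasDerivAt_pow_mul_eval k _ ρ hy2)]
      · simp only [eulerOp, Polynomial.eval_sub, Polynomial.eval_mul, Polynomial.eval_C,
          Polynomial.eval_X]
        field_simp
        ring
      · filter_upwards [isOpen_ne.mem_nhds hy2] with t ht
        refine (hasDerivAt_pow_mul_eval (k + 1) q ρ ht).congr_deriv ?_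
        have : t ≠ 0 := ht
        push_cast
        field_simp
        ring
    have h2 : nlap (fun y : E => (‖y‖ ^ 2) ^ (k + 1) * q.eval (ρ / ‖y‖ ^ 2)) =ᶠ[nhds z]
        fun y => (-4) *
          ((‖y‖ ^ 2) ^ k * (eulerOp (k + n / 2) (eulerOp (k + 1) q)).eval (ρ / ‖y‖ ^ 2)) := by
      filter_upwards [isOpen_ne.mem_nhds hz] with y hy using h1 y hy
    rw [nlapIter_succ, (nlapIter_congr k h2).eq_of_nhds]
    have h3 := ih (Polynomial.C (-4) * eulerOp (k + n / 2) (eulerOp (k + 1) q)) hz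
    have h4 : ∀ (k : ℕ) (q : Polynomial ℝ), lapProfile n k (Polynomial.C (-4) * q) =
        Polynomial.C (-4) * lapProfile n k q := by
      intro k
      induction k with
      | zero => intro q; rfl
      | succ k ih =>
        intro q
        rw [lapProfile, lapProfile, ← ih]
        congr 1
        ext i
        simp only [coeff_eulerOp, Polynomial.coeff_C_mul]
        ring
    rw [h4] at h3
    simp only [Polynomial.eval_mul, Polynomial.eval_C] at h3
    rw [lapProfile, pow_succ, mul_assoc, ← h3]
    congr 1
    ext y
    ring

lemma lapProfile_eq (n m : ℕ) (q : Polynomial ℝ) :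
    lapProfile n m q =
      eulerIter (fun j => if j < m then (j : ℝ) + 1 else n / 2 + (j - m : ℕ)) (2 * m) q := by
  have h : ∀ k i, (lapProfile n k q).coeff i =
      (∏ j ∈ Finset.range k, ((j + 1 : ℝ) - i) * (n / 2 + j - i)) * q.coeff i := by
    intro k i
    induction k generalizing q with
    | zero => simp [lapProfile]
    | succ k ih =>
      rw [lapProfile, ih, coeff_eulerOp, coeff_eulerOp, Finset.prod_range_succ]
      ring
  ext i
  rw [h, coeff_eulerIter, two_mul, Finset.prod_range_add, Finset.prod_mul_distrib]
  congr 2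
  · refine Finset.prod_congr rfl fun j hj => ?_
    rw [if_pos (Finset.mem_range.1 hj)]
  · refine Finset.prod_congr rfl fun j hj => ?_
    rw [if_neg (by omega), Nat.add_sub_cancel_left]

lemma exists_bounds_lapProfile {m n : ℕ} (hn : 2 * m ≤ n) (hm : 0 < m) :
    ∃ C c δ : ℝ, 0 < c ∧ 0 < δ ∧ ∀ τ ∈ Icc (0 : ℝ) 1,
      0 ≤ (lapProfile n m ((1 - Polynomial.X) ^ (2 * m + 1))).eval τ ∧
      (lapProfile n m ((1 - Polynomial.X) ^ (2 * m + 1))).eval τ ≤ C ∧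
      (τ < δ → c ≤ (lapProfile n m ((1 - Polynomial.X) ^ (2 * m + 1))).eval τ) := by
  set P := lapProfile n m ((1 - Polynomial.X) ^ (2 * m + 1)) with hP
  have hn' : (m : ℝ) ≤ n / 2 := by
    rw [le_div_iff₀ two_pos]; exact_mod_cast (by omega)
  have hm' : (0 : ℝ) < m := by exact_mod_cast hm
  have hmem : P ∈ bernsteinCone (2 * m + 1) (2 * m) := by
    rw [hP, lapProfile_eq]
    refine eulerIter_mem_bernsteinCone (fun j => ?_) _ (by omega)
    split_ifs with h
    · linarith
    · rw [Nat.cast_sub (by omega)]; linarith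
  have h0 : 0 < P.eval 0 := by
    rw [← Polynomial.coeff_zero_eq_eval_zero, hP, lapProfile_eq, coeff_eulerIter]
    refine mul_pos (Finset.prod_pos fun j _ => ?_) (by simp [Polynomial.coeff_zero_eq_eval_zero])
    split_ifs with h
    · simp only [Nat.cast_zero, sub_zero]; positivity
    · have : (0 : ℝ) ≤ (j - m : ℕ) := Nat.cast_nonneg _
      simp only [Nat.cast_zero, sub_zero]; linarith
  obtain ⟨C, hC⟩ := isCompact_Icc.bddAbove_image (K := Icc (0 : ℝ) 1)
    (f := fun τ => P.eval τ) P.continuous.continuousOn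
  obtain ⟨δ, hδ, h⟩ := Metric.continuousAt_iff.1 (P.continuous.continuousAt (x := (0 : ℝ)))
    (P.eval 0 / 2) (half_pos h0)
  refine ⟨C, P.eval 0 / 2, δ, half_pos h0, hδ, fun τ hτ =>
    ⟨eval_nonneg_of_mem_bernsteinCone hmem hτ.1 hτ.2, hC ⟨τ, hτ, rfl⟩, fun hlt => ?_⟩⟩
  have := h (x := τ) (by rw [Real.dist_eq, sub_zero, abs_of_nonneg hτ.1]; exact hlt)
  rw [Real.dist_eq, abs_lt] at this
  linarith [this.1]

lemma hasDerivAt_max_zero_pow (k : ℕ) (x : ℝ) :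
    HasDerivAt (fun x : ℝ => max x 0 ^ (k + 2)) ((k + 2) * max x 0 ^ (k + 1)) x := by
  have hne : ∀ y : ℝ, y ≠ 0 →
      HasDerivAt (fun x : ℝ => max x 0 ^ (k + 2)) ((k + 2) * max y 0 ^ (k + 1)) y := by
    intro y hy
    rcases hy.lt_or_gt with h | h
    · rw [max_eq_right h.le, zero_pow (by omega), mul_zero]
      refine (hasDerivAt_const y (0 : ℝ)).congr_of_eventuallyEq ?_
      filter_upwards [isOpen_Iio.mem_nhds h] with z hz
      rw [max_eq_right (le_of_lt hz), zero_pow (by omega)]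
    · rw [max_eq_left h.le]
      have h1 := hasDerivAt_pow (k + 2) y
      push_cast at h1
      refine h1.congr_of_eventuallyEq ?_
      filter_upwards [isOpen_Ioi.mem_nhds h] with z hz
      rw [max_eq_left (le_of_lt hz)]
  by_cases hx : x = 0
  · subst hx
    exact hasDerivAt_of_hasDerivAt_of_ne (g := fun y => (k + 2) * max y 0 ^ (k + 1)) hne
      (by fun_prop) (by fun_prop)
  · exact hne x hx

lemma contDiff_max_zero_pow (k : ℕ) : ContDiff ℝ k (fun x : ℝ => max x 0 ^ (k + 1)) := by
  induction k with
  | zero => exact contDiff_zero.2 (by fun_prop)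
  | succ k ih =>
    have := contDiff_succ_iff_deriv (𝕜 := ℝ) (n := k) (f := fun x : ℝ => max x 0 ^ (k + 1 + 1))
    push_cast
    refine this.2 ⟨fun x => (hasDerivAt_max_zero_pow k x).differentiableAt, by simp, ?_⟩
    rw [show deriv (fun x : ℝ => max x 0 ^ (k + 1 + 1)) =
      fun x : ℝ => (k + 2) * max x 0 ^ (k + 1) from
      funext fun x => (hasDerivAt_max_zero_pow k x).deriv]
    exact contDiff_const.mul ih

/-- A radial test function vanishing for `‖y‖ ≤ r`. -/
def radialTest (m n : ℕ) (r : ℝ) (y : EuclideanSpace ℝ (Fin n)) : ℝ :=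
  (‖y‖ ^ 2) ^ m * max (1 - r ^ 2 / ‖y‖ ^ 2) 0 ^ (2 * m + 1)

lemma radialTest_eq_zero {m : ℕ} {r : ℝ} {y : E} (hm : 0 < m) (hy : ‖y‖ ≤ r) :
    radialTest m n r y = 0 := by
  by_cases h0 : y = 0
  · simp [radialTest, h0, hm.ne']
  · have : 1 - r ^ 2 / ‖y‖ ^ 2 ≤ 0 := by
      have : 0 < ‖y‖ := norm_pos_iff.2 h0
      rw [sub_nonpos, one_le_div (by positivity)]
      gcongr
    rw [radialTest, max_eq_right this]
    simp

lemma radialTest_nonneg (m : ℕ) (r : ℝ) (y : E) : 0 ≤ radialTest m n r y := by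
  rw [radialTest]; positivity

lemma radialTest_le (m : ℕ) (r : ℝ) (y : E) : radialTest m n r y ≤ ‖y‖ ^ (2 * m) := by
  rw [radialTest, pow_mul]
  refine mul_le_of_le_one_right (by positivity) (pow_le_one₀ (le_max_right _ _) ?_)
  exact max_le (by linarith [show 0 ≤ r ^ 2 / ‖y‖ ^ 2 by positivity]) zero_le_one

lemma tsupport_radialTest_subset {m : ℕ} {r : ℝ} (hm : 0 < m) (hr : 0 < r) :
    tsupport (radialTest m n r) ⊆ ({0}ᶜ : Set E) := by
  intro x hx h0
  rw [mem_singleton_iff.1 h0] at hx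
  refine notMem_tsupport_iff_eventuallyEq.2 ?_ hx
  filter_upwards [ball_mem_nhds (0 : E) hr] with y hy
  exact radialTest_eq_zero hm (by simpa using (mem_ball.1 hy).le)

lemma contDiff_radialTest {m : ℕ} {r : ℝ} (hm : 0 < m) (hr : 0 < r) :
    ContDiff ℝ (2 * m : ℕ) (radialTest m n r) := by
  refine contDiff_iff_contDiffAt.2 fun x => ?_
  by_cases hx : x ∈ tsupport (radialTest m n r)
  swap
  · exact contDiffAt_const.congr_of_eventuallyEq (notMem_tsupport_iff_eventuallyEq.1 hx)
  have hx0 : x ≠ 0 := tsupport_radialTest_subset hm hr hx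
  have h1 : ContDiff ℝ (2 * m : ℕ) (fun y : E => ‖y‖ ^ 2) := contDiff_norm_sq ℝ
  have h2 : ContDiffAt ℝ (2 * m : ℕ) (fun y : E => 1 - r ^ 2 / ‖y‖ ^ 2) x :=
    contDiffAt_const.sub (contDiffAt_const.div h1.contDiffAt
      (pow_ne_zero _ (norm_ne_zero_iff.2 hx0)))
  exact (h1.contDiffAt.pow m).mul ((contDiff_max_zero_pow (2 * m)).contDiffAt.comp x h2)

lemma nlapIter_radialTest {m : ℕ} {r : ℝ} (hr : 0 < r) {y : E}
    (hy : r < ‖y‖) : nlapIter m (radialTest m n r) y =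
      (-4) ^ m * (lapProfile n m ((1 - Polynomial.X) ^ (2 * m + 1))).eval (r ^ 2 / ‖y‖ ^ 2) := by
  rw [← nlapIter_pow_mul_eval m _ (r ^ 2) (norm_pos_iff.1 (hr.trans hy))]
  refine (nlapIter_congr m ?_).eq_of_nhds
  filter_upwards [(isOpen_lt continuous_const continuous_norm).mem_nhds hy] with z hz
  have hz' : r < ‖z‖ := hz
  rw [radialTest, max_eq_left]
  · simp
  · rw [sub_nonneg, div_le_one (pow_pos (hr.trans hz') 2)]
    gcongr

/-- One-sided integrability of a function upgrades to integrability, given a weighted bound on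
its poly-Laplacian. -/
lemma integrable_of_integrable_max_zero {m : ℕ} (hm : 0 < m) (hn : 2 * m ≤ n) {w : E → ℝ}
    (hw : ContDiffOn ℝ (2 * m : ℕ) w {0}ᶜ) (hwc : HasCompactSupport w)
    (hg : Integrable fun y => ‖y‖ ^ (2 * m) * nlapIter m w y)
    (hplus : Integrable fun y => max (w y) 0) : Integrable w := by
  have : Nonempty (Fin n) := ⟨⟨0, by omega⟩⟩
  have hU : IsOpen ({0}ᶜ : Set E) := isOpen_compl_singleton
  have hwcont := hw.continuousOn
  have hwm : AEStronglyMeasurable w volume := by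
    have h := hwcont.aestronglyMeasurable (μ := volume) hU.measurableSet
    rwa [restrict_compl_singleton] at h
  obtain ⟨C, c, δ, hc, hδ, hP⟩ := exists_bounds_lapProfile hn hm
  set M := ∫ y, ‖‖y‖ ^ (2 * m) * nlapIter m w y‖ with hM
  set I := ∫ y, max (w y) 0 with hI
  have hminus : ∀ r, 0 < r → IntegrableOn (fun y => max (-w y) 0) {y | r < ‖y‖} ∧
      ∫ y in {y | r < ‖y‖}, ‖max (-w y) 0‖ ≤ (C * I + M) / c := by
    intro r₀ hr₀
    set r := r₀ * min (δ / 2) (1 / 2) with hr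
    have hmin : 0 < min (δ / 2) (1 / 2) := by positivity
    have hrpos : 0 < r := by positivity
    have hrr : r < r₀ := by
      have := min_le_right (δ / 2) (1 / 2)
      rw [hr]; nlinarith
    set Q : E → ℝ := fun y => (-1) ^ m * nlapIter m (radialTest m n r) y / 4 ^ m with hQ
    have hQc : Continuous Q :=
      (continuous_const.mul (contDiff_radialTest hm hrpos).continuous_nlapIter).div_const _
    have hQ1 : ∀ y : E, r < ‖y‖ →
        Q y = (lapProfile n m ((1 - Polynomial.X) ^ (2 * m + 1))).eval (r ^ 2 / ‖y‖ ^ 2) := by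
      intro y hy
      rw [hQ]
      simp only
      rw [nlapIter_radialTest hrpos hy, ← mul_assoc, ← mul_pow]
      norm_num
    have hQ0 : ∀ y : E, ‖y‖ < r → Q y = 0 := by
      intro y hy
      have : nlapIter m (radialTest m n r) y = 0 := by
        refine nlapIter_eq_zero_of_eventuallyEq ?_
        filter_upwards [(isOpen_lt continuous_norm continuous_const).mem_nhds hy] with z hz
        exact radialTest_eq_zero hm (le_of_lt hz)
      simp [hQ, this]
    have hQb : ∀ᵐ y : E, 0 ≤ Q y ∧ Q y ≤ C ∧ (r₀ < ‖y‖ → c ≤ Q y) := by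
      have hs : volume (sphere (0 : E) r) = 0 := Measure.addHaar_sphere _ _ _
      filter_upwards [compl_mem_ae_iff.2 hs] with y hy
      have hy' : ‖y‖ ≠ r := by simpa using hy
      rcases hy'.lt_or_gt with h | h
      · rw [hQ0 y h]
        have h3 := hP 0 ⟨le_rfl, zero_le_one⟩
        exact ⟨le_rfl, h3.1.trans h3.2.1, fun h' => by linarith⟩
      · rw [hQ1 y h]
        have hy0 : 0 < ‖y‖ := hrpos.trans h
        have h3 := hP (r ^ 2 / ‖y‖ ^ 2) ⟨by positivity, by
          rw [div_le_one (by positivity)]; gcongr⟩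
        refine ⟨h3.1, h3.2.1, fun h' => h3.2.2 ?_⟩
        rw [div_lt_iff₀ (by positivity)]
        have h4 : r ^ 2 ≤ r₀ ^ 2 * (δ / 2) := by
          have a1 := min_le_left (δ / 2) (1 / 2)
          have a2 := min_le_right (δ / 2) (1 / 2)
          rw [hr, mul_pow]
          gcongr
          nlinarith
        have h5 : r₀ ^ 2 < ‖y‖ ^ 2 := by gcongr
        nlinarith
    have hQs : tsupport Q ⊆ ({0}ᶜ : Set E) := by
      refine (Subset.trans ?_ (tsupport_nlapIter_subset m _)).trans
        (tsupport_radialTest_subset hm hrpos)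
      refine closure_mono fun y hy => ?_
      contrapose! hy
      simp only [Function.mem_support, not_not] at hy ⊢
      simp [hQ, hy]
    have hwQ : Integrable fun y => w y * Q y :=
      (hwcont.continuous_mul_of_tsupport_subset hU hQc hQs).integrable_of_hasCompactSupport
        (.mul_of_or (.inl hwc))
    have hwQ' : |∫ y, w y * Q y| ≤ M := by
      have e : ∫ y, w y * Q y =
          (-1) ^ m / 4 ^ m * ∫ y, nlapIter m w y * radialTest m n r y := by
        rw [← integral_mul_nlapIter hU m hw (contDiff_radialTest hm hrpos)
          (tsupport_radialTest_subset hm hrpos) (.inl hwc), ← integral_const_mul]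
        refine integral_congr_ae (.of_forall fun y => ?_)
        simp only [hQ]
        ring
      rw [e, abs_mul]
      have h6 : |∫ y, nlapIter m w y * radialTest m n r y| ≤ M := by
        rw [← Real.norm_eq_abs]
        refine norm_integral_le_of_norm_le hg.norm (.of_forall fun y => ?_)
        rw [norm_mul, norm_mul, mul_comm]
        gcongr
        rw [Real.norm_of_nonneg (radialTest_nonneg m r y), norm_pow, norm_norm]
        exact radialTest_le m r y
      have h7 : |((-1) ^ m / 4 ^ m : ℝ)| ≤ 1 := by
        rw [abs_div, abs_pow, abs_neg, abs_one, one_pow, abs_of_pos (by positivity)]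
        exact div_le_one_of_le₀ (one_le_pow₀ (by norm_num)) (by positivity)
      calc _ ≤ 1 * M := by gcongr
        _ = M := one_mul M
    have hpQ : Integrable fun y => max (w y) 0 * Q y := by
      refine hplus.mul_bdd (c := C) hQc.aestronglyMeasurable ?_
      filter_upwards [hQb] with y hy
      rw [Real.norm_of_nonneg hy.1]
      exact hy.2.1
    have hmQ : Integrable fun y => max (-w y) 0 * Q y := by
      refine (hpQ.sub hwQ).congr (.of_forall fun y => ?_)
      simp only [Pi.sub_apply, ← sub_mul]
      rcases le_total (w y) 0 with h | h
      · rw [max_eq_right h, max_eq_left (by linarith), zero_sub]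
      · rw [max_eq_left h, max_eq_right (by linarith), sub_self]
    have hmb : ∫ y, max (-w y) 0 * Q y ≤ C * I + M := by
      have e : ∫ y, max (-w y) 0 * Q y = (∫ y, max (w y) 0 * Q y) - ∫ y, w y * Q y := by
        rw [← integral_sub hpQ hwQ]
        refine integral_congr_ae (.of_forall fun y => ?_)
        simp only [← sub_mul]
        rcases le_total (w y) 0 with h | h
        · rw [max_eq_right h, max_eq_left (by linarith), zero_sub]
        · rw [max_eq_left h, max_eq_right (by linarith), sub_self]
      have e2 : ∫ y, max (w y) 0 * Q y ≤ C * I := by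
        rw [hI, ← integral_const_mul]
        refine integral_mono_ae hpQ (hplus.const_mul C) ?_
        filter_upwards [hQb] with y hy
        rw [mul_comm]
        exact mul_le_mul_of_nonneg_right hy.2.1 (le_max_right _ _)
      linarith [(abs_le.1 hwQ').1]
    have hmeas : MeasurableSet {y : E | r₀ < ‖y‖} :=
      (isOpen_lt continuous_const continuous_norm).measurableSet
    have hle : ∀ᵐ y ∂(volume.restrict {y : E | r₀ < ‖y‖}),
        ‖max (-w y) 0‖ ≤ c⁻¹ * (max (-w y) 0 * Q y) := by
      rw [ae_restrict_iff' hmeas]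
      filter_upwards [hQb] with y hy h
      rw [Real.norm_of_nonneg (le_max_right _ _)]
      have := hy.2.2 h
      rw [inv_mul_eq_div, le_div_iff₀ hc]
      exact mul_le_mul_of_nonneg_left this (le_max_right _ _)
    have hintegrable : IntegrableOn (fun y => max (-w y) 0) {y | r₀ < ‖y‖} :=
      (hmQ.integrableOn.const_mul c⁻¹).mono'
        ((hwm.neg.sup aestronglyMeasurable_const).restrict) hle
    refine ⟨hintegrable, ?_⟩
    calc _ ≤ ∫ y in {y : E | r₀ < ‖y‖}, c⁻¹ * (max (-w y) 0 * Q y) :=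
          integral_mono_ae hintegrable.norm (hmQ.integrableOn.const_mul c⁻¹) hle
      _ ≤ ∫ y, c⁻¹ * (max (-w y) 0 * Q y) := by
          refine setIntegral_le_integral (hmQ.const_mul c⁻¹) ?_
          filter_upwards [hQb] with y hy
          have := hy.1
          simp only [Pi.zero_apply]
          positivity
      _ ≤ _ := by
          rw [integral_const_mul, div_eq_inv_mul]
          gcongr
  have hcover : AECover (volume : Measure E) Filter.atTop
      fun k : ℕ => {y : E | 1 / ((k : ℝ) + 1) < ‖y‖} := by
    refine ⟨?_, fun k => (isOpen_lt continuous_const continuous_norm).measurableSet⟩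
    have h0 : ∀ᵐ y : E, y ≠ 0 := Measure.ae_ne volume 0
    filter_upwards [h0] with y hy
    exact (tendsto_one_div_add_atTop_nhds_zero_nat).eventually (gt_mem_nhds (norm_pos_iff.2 hy))
  have hmi : Integrable fun y => max (-w y) 0 :=
    hcover.integrable_of_integral_norm_bounded ((C * I + M) / c)
      (fun k => (hminus _ (by positivity)).1)
      (.of_forall fun k => (hminus _ (by positivity)).2)
  refine (hplus.sub hmi).congr (.of_forall fun y => ?_)
  simp only [Pi.sub_apply]
  rcases le_total (w y) 0 with h | h
  · rw [max_eq_right h, max_eq_left (by linarith)]; ring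
  · rw [max_eq_left h, max_eq_right (by linarith)]; ring

end RadialTestFunction

section TaylorRemainder

variable {n : ℕ}

local notation "E" => EuclideanSpace ℝ (Fin n)

lemma mem_degLT {s : ℕ} {β : Fin n → ℕ} : β ∈ degLT n s ↔ ∑ i, β i < s := by
  simp only [degLT, Finset.mem_filter, Fintype.mem_piFinset, Finset.mem_range,
    and_iff_right_iff_imp]
  exact fun h i => (Finset.single_le_sum (fun j _ => Nat.zero_le (β j)) (Finset.mem_univ
    i)).trans_lt h

lemma mem_degLE {s : ℕ} {β : Fin n → ℕ} : β ∈ degLE n s ↔ ∑ i, β i ≤ s := by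
  simp only [degLE, Finset.mem_filter, Fintype.mem_piFinset, Finset.mem_range,
    and_iff_right_iff_imp]
  exact fun h i => Nat.lt_succ_of_le
    ((Finset.single_le_sum (fun j _ => Nat.zero_le (β j)) (Finset.mem_univ i)).trans h)

/-- The normalized monomial `z^β / β!`. -/
def monom (β : Fin n → ℕ) (z : E) : ℝ := (∏ i, z i ^ β i) / ∏ i, ((β i).factorial : ℝ)

lemma monom_eq_prod (β : Fin n → ℕ) :
    monom β = fun z : E => ∏ i, (z i ^ β i / ((β i).factorial : ℝ)) := by
  ext z
  rw [monom, Finset.prod_div_distrib]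

lemma contDiff_monom (β : Fin n → ℕ) {k : WithTop ℕ∞} : ContDiff ℝ k (monom β : E → ℝ) := by
  rw [monom_eq_prod]
  refine contDiff_prod fun i _ => ?_
  exact (((EuclideanSpace.proj i : E →L[ℝ] ℝ).contDiff).pow (β i)).div_const _

lemma hasFDerivAt_coord_pow (j : Fin n) (k : ℕ) (z : E) :
    HasFDerivAt (fun z : E => z j ^ k / (k.factorial : ℝ))
      ((k * z j ^ (k - 1) / (k.factorial : ℝ)) • (EuclideanSpace.proj j : E →L[ℝ] ℝ)) z := by
  have h1 : HasDerivAt (fun t : ℝ => t ^ k / (k.factorial : ℝ))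
      (k * z j ^ (k - 1) / (k.factorial : ℝ)) ((EuclideanSpace.proj j : E →L[ℝ] ℝ) z) :=
    (hasDerivAt_pow k _).div_const _
  exact h1.comp_hasFDerivAt z (EuclideanSpace.proj j : E →L[ℝ] ℝ).hasFDerivAt

lemma pderiv1_monom (i : Fin n) (β : Fin n → ℕ) (z : E) :
    pderiv1 i (monom β) z = (∏ j ∈ Finset.univ.erase i, (z j ^ β j / ((β j).factorial : ℝ))) *
      (β i * z i ^ (β i - 1) / ((β i).factorial : ℝ)) := by
  have h := HasFDerivAt.finsetProd (u := Finset.univ) (x := z)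
    (g := fun j (z : E) => z j ^ β j / ((β j).factorial : ℝ))
    (fun j _ => hasFDerivAt_coord_pow j (β j) z)
  rw [monom_eq_prod, pderiv1, h.fderiv, sum_apply,
    Finset.sum_eq_single i]
  · simp
  · intro j _ hj
    simp [hj]
  · simp

lemma pderiv1_monom_of_eq_zero {i : Fin n} {β : Fin n → ℕ} (h : β i = 0) :
    pderiv1 i (monom β) = (0 : E → ℝ) := by
  ext z
  rw [pderiv1_monom, h]
  simp

lemma pderiv1_monom_add_single (i : Fin n) (γ : Fin n → ℕ) :
    pderiv1 i (monom (γ + Pi.single i 1)) = (monom γ : E → ℝ) := by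
  ext z
  rw [pderiv1_monom, monom_eq_prod]
  simp only
  rw [← Finset.prod_erase_mul _ _ (Finset.mem_univ i)]
  congr 1
  · refine Finset.prod_congr rfl fun j hj => ?_
    rw [Pi.add_apply, Pi.single_eq_of_ne (Finset.ne_of_mem_erase hj), add_zero]
  · simp only [Pi.add_apply, Pi.single_eq_same, Nat.add_sub_cancel, Nat.factorial_succ]
    have : ((γ i).factorial : ℝ) ≠ 0 := by positivity
    push_cast
    have : (γ i : ℝ) + 1 ≠ 0 := by positivity
    field_simp

lemma pderiv1_iterate_comm {F : E → ℝ} (hF : ContDiff ℝ (⊤ : ℕ∞) F) (i j : Fin n) (k : ℕ) :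
    pderiv1 i ((pderiv1 j)^[k] F) = (pderiv1 j)^[k] (pderiv1 i F) := by
  induction k generalizing F with
  | zero => rfl
  | succ k ih =>
    rw [Function.iterate_succ_apply, ih (hF.pderiv1_infty j), Function.iterate_succ_apply,
      pderiv1_comm (contDiff_infty.1 hF 2)]

lemma contDiff_iterate_pderiv1 {F : E → ℝ} (hF : ContDiff ℝ (⊤ : ℕ∞) F) (j : Fin n) (k : ℕ) :
    ContDiff ℝ (⊤ : ℕ∞) ((pderiv1 j)^[k] F) := by
  induction k generalizing F with
  | zero => exact hF
  | succ k ih => exact ih (hF.pderiv1_infty j)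

lemma listDeriv_add_single_of_notMem {i : Fin n} (β : Fin n → ℕ) {l : List (Fin n)} (hi : i ∉ l)
    (F : E → ℝ) : listDeriv (β + Pi.single i 1) l F = listDeriv β l F := by
  induction l generalizing F with
  | nil => rfl
  | cons a l ih =>
    rw [List.mem_cons, not_or] at hi
    rw [listDeriv_cons, listDeriv_cons, ih hi.2, Pi.add_apply,
      Pi.single_eq_of_ne (Ne.symm hi.1), add_zero]

lemma listDeriv_add_single {i : Fin n} (β : Fin n → ℕ) {l : List (Fin n)} (hl : l.Nodup)
    (hi : i ∈ l) {F : E → ℝ} (hF : ContDiff ℝ (⊤ : ℕ∞) F) :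
    listDeriv (β + Pi.single i 1) l F = listDeriv β l (pderiv1 i F) := by
  induction l generalizing F with
  | nil => simp at hi
  | cons a l ih =>
    rw [List.nodup_cons] at hl
    rw [listDeriv_cons, listDeriv_cons]
    by_cases ha : a = i
    · subst ha
      rw [listDeriv_add_single_of_notMem β hl.1, Pi.add_apply, Pi.single_eq_same,
        Function.iterate_succ_apply]
    · rw [ih hl.2 ((List.mem_cons.1 hi).resolve_left (Ne.symm ha))
        (contDiff_iterate_pderiv1 hF _ _), Pi.add_apply, Pi.single_eq_of_ne ha, add_zero,
        pderiv1_iterate_comm hF]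

lemma mderiv_add_single (i : Fin n) (β : Fin n → ℕ) {F : E → ℝ}
    (hF : ContDiff ℝ (⊤ : ℕ∞) F) : mderiv (β + Pi.single i 1) F = mderiv β (pderiv1 i F) := by
  rw [mderiv_eq_listDeriv, mderiv_eq_listDeriv,
    listDeriv_add_single β (List.nodup_finRange n) (List.mem_finRange i) hF]

lemma mderiv_zero (F : E → ℝ) : mderiv 0 F = F := by
  rw [mderiv_eq_listDeriv]
  generalize List.finRange n = l
  induction l generalizing F with
  | nil => rfl
  | cons a l ih => rw [listDeriv_cons]; exact ih F

/-- The remainder of the Taylor expansion of `F` at `x` of degree less than `K`. -/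
def taylorRem (K : ℕ) (F : E → ℝ) (x z : E) : ℝ :=
  F (x + z) - ∑ β ∈ degLT n K, monom β z * mderiv β F x

lemma contDiff_taylorRem (K : ℕ) {F : E → ℝ} (hF : ContDiff ℝ (⊤ : ℕ∞) F) (x : E) :
    ContDiff ℝ (⊤ : ℕ∞) (taylorRem K F x) :=
  (hF.comp (contDiff_const.add contDiff_id)).sub
    (ContDiff.sum fun β _ => (contDiff_monom β).mul contDiff_const)

lemma taylorRem_zero_right (K : ℕ) (F : E → ℝ) (x : E) : taylorRem (K + 1) F x 0 = 0 := by
  rw [taylorRem, Finset.sum_eq_single 0]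
  · simp [mderiv_zero, monom]
  · intro β _ hβ
    obtain ⟨i, hi⟩ := Function.ne_iff.1 hβ
    rw [monom, Finset.prod_eq_zero (Finset.mem_univ i)]
    · simp
    · simp only [PiLp.zero_apply]
      exact zero_pow hi
  · intro h
    exact absurd (mem_degLT.2 (by simp)) h

lemma pderiv1_taylorRem (K : ℕ) {F : E → ℝ} (hF : ContDiff ℝ (⊤ : ℕ∞) F) (x : E) (i : Fin n) :
    pderiv1 i (taylorRem (K + 1) F x) = taylorRem K (pderiv1 i F) x := by
  ext z
  have h1 : DifferentiableAt ℝ (fun z => F (x + z)) z :=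
    (hF.comp (contDiff_const.add contDiff_id)).differentiable (by simp) z
  have h2 : ∀ β ∈ degLT n (K + 1), DifferentiableAt ℝ (fun z : E => monom β z * mderiv β F x) z :=
    fun β _ => ((contDiff_monom (k := 1) β).differentiable one_ne_zero z).mul_const _
  have e : taylorRem (K + 1) F x =
    fun z => F (x + z) - ∑ β ∈ degLT n (K + 1), monom β z * mderiv β F x := rfl
  rw [e, pderiv1, fderiv_fun_sub h1 (DifferentiableAt.fun_sum h2), fderiv_fun_sum h2,
    fderiv_comp_add_left, sub_apply, sum_apply, taylorRem]
  congr 1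
  have h3 : ∀ β, (fderiv ℝ (fun z : E => monom β z * mderiv β F x) z) (EuclideanSpace.single i 1) =
      pderiv1 i (monom β) z * mderiv β F x := fun β => by
    rw [fderiv_mul_const ((contDiff_monom (k := 1) β).differentiable one_ne_zero z)]
    simp [pderiv1, mul_comm]
  simp only [h3]
  symm
  refine Finset.sum_of_injOn (fun γ => γ + Pi.single i 1) (fun _ _ _ _ h => add_right_cancel h)
    (fun γ hγ => ?_) (fun β _ hβ => ?_) (fun γ _ => ?_)
  · have := mem_degLT.1 (Finset.mem_coe.1 hγ)
    refine Finset.mem_coe.2 (mem_degLT.2 ?_)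
    simp only [Pi.add_apply, Finset.sum_add_distrib, Finset.sum_pi_single', Finset.mem_univ,
      if_true]
    omega
  · have h0 : β i = 0 := by
      by_contra h0
      rename_i hβm
      have hb : β - Pi.single i 1 + Pi.single i 1 = β := by
        ext j
        by_cases hj : j = i
        · subst hj; simp; omega
        · simp [Pi.single_eq_of_ne hj]
      refine hβ ⟨β - Pi.single i 1, Finset.mem_coe.2 (mem_degLT.2 ?_), hb⟩
      have h4 := mem_degLT.1 hβm
      rw [← hb] at h4
      simp only [Pi.add_apply, Finset.sum_add_distrib, Finset.sum_pi_single', Finset.mem_univ,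
        if_true] at h4
      omega
    rw [pderiv1_monom_of_eq_zero h0]
    simp
  · rw [pderiv1_monom_add_single, mderiv_add_single i γ hF]

lemma iteratedFDeriv_succ_eq_zero {H : E → ℝ} (hH : ContDiff ℝ (⊤ : ℕ∞) H) {j : ℕ} {x : E}
    (h : ∀ i, iteratedFDeriv ℝ j (pderiv1 i H) x = 0) : iteratedFDeriv ℝ (j + 1) H x = 0 := by
  ext v
  rw [iteratedFDeriv_succ_apply_right]
  have hf : ContDiff ℝ j (fderiv ℝ H) := hH.fderiv_right (by exact_mod_cast le_top)
  have key : iteratedFDeriv ℝ j (fderiv ℝ H) x (Fin.init v) = 0 := by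
    refine ContinuousLinearMap.coe_injective
      ((EuclideanSpace.basisFun (Fin n) ℝ).toBasis.ext fun i => ?_)
    have h1 :=
      (ContinuousLinearMap.apply ℝ ℝ (EuclideanSpace.single i (1 : ℝ) : E)).iteratedFDeriv_comp_left
      hf.contDiffAt (x := x) le_rfl
    have h2 := congrArg (fun L => L (Fin.init v)) (h1.symm.trans (h i))
    simpa using h2
  rw [key]
  simp

lemma iteratedFDeriv_taylorRem (K : ℕ) {F : E → ℝ} (hF : ContDiff ℝ (⊤ : ℕ∞) F) (x : E) {j : ℕ}
    (hj : j < K) : iteratedFDeriv ℝ j (taylorRem K F x) 0 = 0 := by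
  induction K generalizing F j with
  | zero => omega
  | succ K ih =>
    cases j with
    | zero =>
      ext v
      simp [taylorRem_zero_right]
    | succ j =>
      refine iteratedFDeriv_succ_eq_zero (contDiff_taylorRem _ hF x) fun i => ?_
      rw [pderiv1_taylorRem K hF]
      exact ih (hF.pderiv1_infty i) (by omega)

lemma exists_norm_iteratedFDeriv_le {H : E → ℝ} (hH : ContDiff ℝ (⊤ : ℕ∞) H) {K : ℕ}
    (h0 : ∀ j < K, iteratedFDeriv ℝ j H 0 = 0) :
    ∃ C, 0 ≤ C ∧ ∀ d ≤ K, ∀ y : E, ‖y‖ ≤ 1 → ‖iteratedFDeriv ℝ (K - d) H y‖ ≤ C * ‖y‖ ^ d := by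
  have hcont : Continuous fun y => ‖iteratedFDeriv ℝ K H y‖ :=
    (hH.continuous_iteratedFDeriv (by exact_mod_cast le_top)).norm
  obtain ⟨C, hC⟩ := (isCompact_closedBall (0 : E) 1).bddAbove_image hcont.continuousOn
  have hC' : ∀ y : E, ‖y‖ ≤ 1 → ‖iteratedFDeriv ℝ K H y‖ ≤ C := fun y hy =>
    hC ⟨y, by simpa using hy, rfl⟩
  have hC0 : 0 ≤ C := (norm_nonneg _).trans (hC' 0 (by simp))
  refine ⟨C, hC0, fun d => ?_⟩
  induction d with
  | zero => intro _ y hy; simpa using hC' y hy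
  | succ d ih =>
    intro hd y hy
    have hdiff : Differentiable ℝ (iteratedFDeriv ℝ (K - (d + 1)) H) :=
      (contDiff_infty.1 hH (K - (d + 1) + 1)).differentiable_iteratedFDeriv
        (by exact_mod_cast Nat.lt_succ_self _)
    have hb : ∀ z ∈ closedBall (0 : E) ‖y‖,
        ‖fderiv ℝ (iteratedFDeriv ℝ (K - (d + 1)) H) z‖ ≤ C * ‖y‖ ^ d := by
      intro z hz
      have hz' : ‖z‖ ≤ ‖y‖ := by simpa using hz
      rw [norm_fderiv_iteratedFDeriv, show K - (d + 1) + 1 = K - d by omega]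
      refine (ih (by omega) z (hz'.trans hy)).trans ?_
      gcongr
    have := (convex_closedBall (0 : E) ‖y‖).norm_image_sub_le_of_norm_fderiv_le
      (fun z _ => hdiff z) hb (mem_closedBall_self (norm_nonneg y)) (by simp : y ∈ closedBall 0 ‖y‖)
    rw [h0 _ (by omega), sub_zero, sub_zero] at this
    rw [pow_succ, ← mul_assoc]
    exact this

lemma exists_norm_iteratedFDeriv_taylorRem_neg_le (K : ℕ) {F : E → ℝ}
    (hF : ContDiff ℝ (⊤ : ℕ∞) F) (x : E) :
    ∃ C, 0 ≤ C ∧ ∀ j ≤ K, ∀ y : E, ‖y‖ ≤ 1 →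
      ‖iteratedFDeriv ℝ j (fun y => taylorRem K F x (-y)) y‖ ≤ C * ‖y‖ ^ (K - j) := by
  obtain ⟨C, hC, h⟩ := exists_norm_iteratedFDeriv_le (contDiff_taylorRem K hF x)
    (fun j => iteratedFDeriv_taylorRem K hF x)
  refine ⟨C, hC, fun j hj y hy => ?_⟩
  have h1 := (LinearIsometryEquiv.neg ℝ : E ≃ₗᵢ[ℝ] E).norm_iteratedFDeriv_comp_right
    (𝕜 := ℝ) (taylorRem K F x) y j
  have h2 := h (K - j) (by omega) (-y) (by simpa using hy)
  rw [norm_neg, Nat.sub_sub_self hj] at h2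
  exact (h1.trans_le h2)

end TaylorRemainder

section Cutoff

variable {n : ℕ}

local notation "E" => EuclideanSpace ℝ (Fin n)

/-- A fixed bump function at the origin. -/
def unitBump (n : ℕ) : ContDiffBump (0 : EuclideanSpace ℝ (Fin n)) :=
  ⟨1 / 2, 1, by norm_num, by norm_num⟩

/-- A smooth function vanishing on the ball of radius `r / 2` and equal to `1` off the ball of
radius `r`. -/
def cutoff (r : ℝ) (y : E) : ℝ := 1 - unitBump n (r⁻¹ • y)

lemma contDiff_cutoff (r : ℝ) {k : ℕ∞} : ContDiff ℝ k (cutoff r : E → ℝ) :=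
  contDiff_const.sub ((unitBump n).contDiff.comp (contDiff_const_smul _))

lemma cutoff_eq_zero {r : ℝ} (hr : 0 < r) {y : E} (hy : ‖y‖ ≤ r / 2) : cutoff r y = 0 := by
  rw [cutoff, ContDiffBump.one_of_mem_closedBall, sub_self]
  rw [mem_closedBall_zero_iff, norm_smul, norm_inv, Real.norm_of_nonneg hr.le,
    inv_mul_le_iff₀ hr]
  simpa [unitBump, div_eq_mul_inv] using hy

lemma cutoff_eq_one {r : ℝ} (hr : 0 < r) {y : E} (hy : r ≤ ‖y‖) : cutoff r y = 1 := by
  rw [cutoff, ContDiffBump.zero_of_le_dist, sub_zero]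
  rw [dist_zero_right, norm_smul, norm_inv, Real.norm_of_nonneg hr.le, le_inv_mul_iff₀ hr]
  simpa [unitBump] using hy

lemma cutoff_nonneg (r : ℝ) (y : E) : 0 ≤ cutoff r y := sub_nonneg.2 (unitBump n).le_one

lemma cutoff_le_one (r : ℝ) (y : E) : cutoff r y ≤ 1 := sub_le_self _ (unitBump n).nonneg

lemma tsupport_cutoff_subset {r : ℝ} (hr : 0 < r) : tsupport (cutoff r) ⊆ ({0}ᶜ : Set E) := by
  intro x hx h0
  rw [mem_singleton_iff.1 h0] at hx
  refine notMem_tsupport_iff_eventuallyEq.2 ?_ hx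
  filter_upwards [ball_mem_nhds (0 : E) (half_pos hr)] with y hy
  exact cutoff_eq_zero hr (by simpa using (mem_ball.1 hy).le)

lemma exists_norm_iteratedFDeriv_cutoff_le (n K : ℕ) :
    ∃ D, 0 ≤ D ∧ ∀ i ≤ K, ∀ r, 0 < r → ∀ y : EuclideanSpace ℝ (Fin n), ‖y‖ ≤ r →
      ‖iteratedFDeriv ℝ i (cutoff r) y‖ ≤ D * (r⁻¹) ^ i := by
  have h : ∀ i : ℕ, ∃ D, ∀ y : EuclideanSpace ℝ (Fin n), ‖y‖ ≤ 1 →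
      ‖iteratedFDeriv ℝ i (cutoff 1) y‖ ≤ D := by
    intro i
    have hcont : Continuous fun y : EuclideanSpace ℝ (Fin n) => ‖iteratedFDeriv ℝ i (cutoff 1) y‖ :=
      ((contDiff_cutoff 1 (k := i)).continuous_iteratedFDeriv le_rfl).norm
    obtain ⟨C, hC⟩ := (isCompact_closedBall (0 : EuclideanSpace ℝ (Fin n)) 1).bddAbove_image
      hcont.continuousOn
    exact ⟨C, fun y hy => hC ⟨y, by simpa using hy, rfl⟩⟩
  choose D hD using h
  have hD0 : ∀ i, 0 ≤ D i := fun i => (norm_nonneg _).trans (hD i 0 (by simp))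
  refine ⟨∑ i ∈ Finset.range (K + 1), D i, Finset.sum_nonneg fun i _ => hD0 i,
    fun i hi r hr y hy => ?_⟩
  have h1 : (cutoff r : EuclideanSpace ℝ (Fin n) → ℝ) = fun y => cutoff 1 (r⁻¹ • y) := by
    ext y
    simp [cutoff]
  rw [h1, iteratedFDeriv_comp_const_smul _ (contDiff_cutoff 1 (k := i)), norm_smul, norm_pow,
    norm_inv, Real.norm_of_nonneg hr.le, mul_comm]
  gcongr
  refine (hD i _ ?_).trans (Finset.single_le_sum (fun i _ => hD0 i) (Finset.mem_range.2 (by omega)))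
  rw [norm_smul, norm_inv, Real.norm_of_nonneg hr.le, inv_mul_le_iff₀ hr, mul_one]
  exact hy

lemma ContDiffOn.contDiff_mul_of_tsupport_subset {k : WithTop ℕ∞} {f g : E → ℝ} {U : Set E}
    (hU : IsOpen U) (hf : ContDiffOn ℝ k f U) (hg : ContDiff ℝ k g) (hgU : tsupport g ⊆ U) :
    ContDiff ℝ k fun x => f x * g x := by
  refine contDiff_iff_contDiffAt.2 fun x => ?_
  by_cases hx : x ∈ tsupport g
  · exact (hf.contDiffAt (hU.mem_nhds (hgU hx))).mul hg.contDiffAt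
  · refine (contDiffAt_const (c := (0 : ℝ))).congr_of_eventuallyEq ?_
    filter_upwards [notMem_tsupport_iff_eventuallyEq.1 hx] with y hy
    simp [hy]

lemma exists_contDiff_eq_fundSol (m n : ℕ) (c : ℝ) {ε : ℝ} (hε : 0 < ε) :
    ∃ F : EuclideanSpace ℝ (Fin n) → ℝ, ContDiff ℝ (⊤ : ℕ∞) F ∧
      ∀ y, ε ≤ ‖y‖ → F y = fundSol m n c y :=
  ⟨fun y => fundSol m n c y * cutoff ε y,
    (contDiffOn_fundSol m n c).contDiff_mul_of_tsupport_subset isOpen_compl_singleton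
      (contDiff_cutoff ε) (tsupport_cutoff_subset hε),
    fun y hy => by simp only [cutoff_eq_one hε hy, mul_one]⟩

end Cutoff

section Representation

variable {n : ℕ}

local notation "E" => EuclideanSpace ℝ (Fin n)

lemma exists_eq_sum_of_tendsto {X ι : Type*} (T : Finset ι) (v : ι → X → ℝ) (a : ℕ → ι → ℝ)
    (f : X → ℝ)
    (h : ∀ x, Filter.Tendsto (fun k => ∑ β ∈ T, a k β * v β x) Filter.atTop (nhds (f x))) :
    ∃ b : ι → ℝ, ∀ x, f x = ∑ β ∈ T, b β * v β x := by
  classical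
  set S : Submodule ℝ (X → ℝ) := Submodule.span ℝ (v '' T) with hS
  have hfin : FiniteDimensional ℝ S :=
    FiniteDimensional.span_of_finite ℝ (T.finite_toSet.image v)
  have hmem : f ∈ S := by
    refine S.closed_of_finiteDimensional.mem_of_tendsto (b := Filter.atTop)
      (f := fun k : ℕ => ∑ β ∈ T, a k β • v β) (tendsto_pi_nhds.2 fun x => ?_)
      (.of_forall fun k => ?_)
    · simpa [Finset.sum_apply] using h x
    · exact Submodule.sum_mem _ fun β hβ =>
        S.smul_mem _ (Submodule.subset_span ⟨β, hβ, rfl⟩)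
  obtain ⟨b, hb⟩ := (Submodule.mem_span_image_finset_iff_exists_fun ℝ).1 hmem
  refine ⟨fun β => if h : β ∈ T then b ⟨β, h⟩ else 0, fun x => ?_⟩
  rw [← hb, Finset.sum_apply, ← Finset.sum_coe_sort T]
  simp

lemma psiFun_eq_taylorRem (m n s : ℕ) (c : ℝ) (x y : EuclideanSpace ℝ (Fin n)) :
    psiFun m n s c x y = taylorRem s (fundSol m n c) x (-y) := by
  simp [psiFun, taylorRem, monom, sub_eq_add_neg]

lemma taylorRem_congr (K : ℕ) {F φ : E → ℝ} {x : E} (hx : x ≠ 0)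
    (h : ∀ y, ‖x‖ / 2 ≤ ‖y‖ → F y = φ y) {y : E} (hy : ‖y‖ ≤ ‖x‖ / 2) :
    taylorRem K φ x (-y) = taylorRem K F x (-y) := by
  have hx' : 0 < ‖x‖ := norm_pos_iff.2 hx
  have h1 : F =ᶠ[nhds x] φ := by
    filter_upwards [(isOpen_lt (continuous_const (y := ‖x‖ / 2)) continuous_norm).mem_nhds
      (show ‖x‖ / 2 < ‖x‖ by linarith)] with z hz
    exact h z (le_of_lt hz)
  have h2 : ‖x‖ / 2 ≤ ‖x + -y‖ := by
    have := norm_sub_norm_le x y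
    rw [← sub_eq_add_neg]
    linarith
  rw [taylorRem, taylorRem, h _ h2]
  congr 1
  exact Finset.sum_congr rfl fun β _ => by rw [(mderiv_congr β h1).eq_of_nhds]

lemma integrable_monom_mul {G : E → ℝ} (hG : Continuous G) (hGc : HasCompactSupport G)
    (β : Fin n → ℕ) : Integrable fun y => monom β (-y) * G y :=
  Continuous.integrable_of_hasCompactSupport
    (((contDiff_monom (k := 0) β).continuous.comp continuous_neg).mul hG) hGc.mul_left

lemma integrable_taylorRem_mul {φ : E → ℝ} (hφ : LocallyIntegrable φ volume) {G : E → ℝ}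
    (hG : Continuous G) (hGc : HasCompactSupport G) (K : ℕ) (x : E) :
    Integrable fun y => taylorRem K φ x (-y) * G y := by
  simp only [taylorRem, sub_mul, Finset.sum_mul, ← sub_eq_add_neg]
  refine (integrable_comp_sub_mul hφ hG hGc x).sub (integrable_finsetSum _ fun β _ => ?_)
  refine ((integrable_monom_mul hG hGc β).const_mul (mderiv β φ x)).congr (.of_forall fun y => ?_)
  simp only
  ring

lemma integral_comp_sub_mul_eq {φ : E → ℝ} (hφ : LocallyIntegrable φ volume) {G : E → ℝ}
    (hG : Continuous G) (hGc : HasCompactSupport G) (K : ℕ) (x : E) :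
    ∫ y, φ (x - y) * G y = (∫ y, taylorRem K φ x (-y) * G y) +
      ∑ β ∈ degLT n K, (∫ y, monom β (-y) * G y) * mderiv β φ x := by
  simp only [← integral_mul_const]
  rw [← integral_finsetSum _ fun β _ => (integrable_monom_mul hG hGc β).mul_const _,
    ← integral_add (integrable_taylorRem_mul hφ hG hGc K x)
      (integrable_finsetSum _ fun β _ => (integrable_monom_mul hG hGc β).mul_const _)]
  refine integral_congr_ae (.of_forall fun y => ?_)
  simp only [taylorRem, sub_mul, Finset.sum_mul, ← sub_eq_add_neg]
  rw [sub_add, ← Finset.sum_sub_distrib, Finset.sum_eq_zero, sub_zero]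
  intro β _
  ring

lemma integrable_psiFun_mul {m s : ℕ} {c : ℝ} (hm : 0 < m) (hn : 2 * m ≤ n) {g : E → ℝ}
    (hg : ContinuousOn g {0}ᶜ) (hgc : HasCompactSupport g)
    (hgs : Integrable fun y => ‖y‖ ^ s * g y) {x : E} (hx : x ≠ 0) :
    Integrable fun y => psiFun m n s c x y * g y := by
  have : Nonempty (Fin n) := ⟨⟨0, by omega⟩⟩
  have hx' : 0 < ‖x‖ := norm_pos_iff.2 hx
  have hU : IsOpen ({0}ᶜ : Set E) := isOpen_compl_singleton
  have hφ := locallyIntegrable_fundSol hm hn c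
  have hgm : AEStronglyMeasurable g volume := by
    have h := hg.aestronglyMeasurable (μ := volume) hU.measurableSet
    rwa [restrict_compl_singleton] at h
  obtain ⟨F, hF, hFφ⟩ := exists_contDiff_eq_fundSol m n c (half_pos hx')
  obtain ⟨C, hC, hCb⟩ := exists_norm_iteratedFDeriv_taylorRem_neg_le s hF x
  set ρ := min 1 (‖x‖ / 2) with hρ
  have hρ0 : 0 < ρ := by positivity
  have hG : Continuous fun y => g y * cutoff ρ y :=
    hg.continuous_mul_of_tsupport_subset hU (contDiff_cutoff ρ (k := 0)).continuous
      (tsupport_cutoff_subset hρ0)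
  simp only [psiFun_eq_taylorRem]
  refine ((integrable_taylorRem_mul hφ hG hgc.mul_right s x).norm.add
    (hgs.norm.const_mul C)).mono' (AEStronglyMeasurable.mul ?_ hgm) (.of_forall fun y => ?_)
  · simp only [taylorRem, ← sub_eq_add_neg]
    refine (hφ.comp_const_sub x).aestronglyMeasurable.sub (Continuous.aestronglyMeasurable ?_)
    exact continuous_finsetSum _ fun β _ =>
      ((contDiff_monom (k := 0) β).continuous.comp continuous_neg).mul continuous_const
  · simp only [Pi.add_apply]
    rcases le_total ρ ‖y‖ with h | h
    · rw [cutoff_eq_one hρ0 h, mul_one]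
      have : 0 ≤ C * ‖‖y‖ ^ s * g y‖ := by positivity
      linarith
    · have h1 := hCb 0 (Nat.zero_le _) y (h.trans (min_le_left _ _))
      rw [norm_iteratedFDeriv_zero, Nat.sub_zero] at h1
      rw [taylorRem_congr s hx hFφ (h.trans (min_le_right _ _)), norm_mul, norm_mul (‖y‖ ^ s),
        norm_pow, norm_norm]
      have h2 : 0 ≤ ‖taylorRem s F x (-y) * (g y * cutoff ρ y)‖ := norm_nonneg _
      have h3 : ‖taylorRem s F x (-y)‖ * ‖g y‖ ≤ C * ‖y‖ ^ s * ‖g y‖ := by gcongr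
      linarith

/-- The commutator error of the cutoff tends to zero against an integrable function. -/
lemma tendsto_integral_taylorRem_error {m : ℕ} {c : ℝ} (hm : 0 < m) (hn : 2 * m ≤ n) {w : E → ℝ}
    (hw : ContDiffOn ℝ (2 * m : ℕ) w {0}ᶜ) (hwc : HasCompactSupport w) (hwi : Integrable w)
    {x : E} (hx : x ≠ 0) {r : ℕ → ℝ} (hr0 : ∀ k, 0 < r k)
    (hr : Filter.Tendsto r Filter.atTop (nhds 0)) :
    Filter.Tendsto (fun k => ∫ y, taylorRem (2 * m) (fundSol m n c) x (-y) *
      (nlapIter m (fun y => w y * cutoff (r k) y) y - nlapIter m w y * cutoff (r k) y))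
      Filter.atTop (nhds 0) := by
  have : Nonempty (Fin n) := ⟨⟨0, by omega⟩⟩
  have hx' : 0 < ‖x‖ := norm_pos_iff.2 hx
  have hU : IsOpen ({0}ᶜ : Set E) := isOpen_compl_singleton
  obtain ⟨F, hF, hFφ⟩ := exists_contDiff_eq_fundSol m n c (half_pos hx')
  obtain ⟨C, hC, hCb⟩ := exists_norm_iteratedFDeriv_taylorRem_neg_le (2 * m) hF x
  obtain ⟨D, hD, hDb⟩ := exists_norm_iteratedFDeriv_cutoff_le n (2 * m)
  set R : E → ℝ := fun y => taylorRem (2 * m) F x (-y) with hR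
  have hRs : ContDiff ℝ (⊤ : ℕ∞) R := (contDiff_taylorRem _ hF x).comp contDiff_neg
  have hχs : ∀ k, ContDiff ℝ (⊤ : ℕ∞) (cutoff (r k) : E → ℝ) := fun k => contDiff_cutoff _
  have hχR : ∀ k, ContDiff ℝ (⊤ : ℕ∞) fun y => cutoff (r k) y * R y := fun k => (hχs k).mul hRs
  have hgcont : ContinuousOn (nlapIter m w) {0}ᶜ := hw.continuousOn_nlapIter hU
  have hV : ∀ k, ContDiff ℝ (2 * m : ℕ) fun y => w y * cutoff (r k) y := fun k =>
    hw.contDiff_mul_of_tsupport_subset hU (contDiff_infty.1 (hχs k) _)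
      (tsupport_cutoff_subset (hr0 k))
  set B : ℕ → E → ℝ := fun k y =>
    cutoff (r k) y * nlapIter m R y - nlapIter m (fun y => cutoff (r k) y * R y) y with hB
  have hBc : ∀ k, Continuous (B k) := fun k =>
    ((hχs k).continuous.mul (contDiff_infty.1 hRs _).continuous_nlapIter).sub
      (contDiff_infty.1 (hχR k) _).continuous_nlapIter
  have hB0 : ∀ k y, r k < ‖y‖ → B k y = 0 := by
    intro k y hy
    have : (fun y => cutoff (r k) y * R y) =ᶠ[nhds y] R := by
      filter_upwards [(isOpen_lt continuous_const continuous_norm).mem_nhds hy] with z hz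
      rw [cutoff_eq_one (hr0 k) (le_of_lt hz), one_mul]
    simp only [hB]
    rw [(nlapIter_congr m this).eq_of_nhds, cutoff_eq_one (hr0 k) hy.le, one_mul, sub_self]
  set M := (n : ℝ) ^ m * C +
    (n : ℝ) ^ m * ∑ i ∈ Finset.range (2 * m + 1), ((2 * m).choose i : ℝ) * D * C with hM
  have hM0 : 0 ≤ M := by positivity
  have hBb : ∀ k y, r k ≤ 1 → ‖B k y‖ ≤ M := by
    intro k y hk
    rcases lt_or_ge (r k) ‖y‖ with h | h
    · rw [hB0 k y h, norm_zero]; exact hM0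
    · have hy1 : ‖y‖ ≤ 1 := h.trans hk
      refine (norm_sub_le _ _).trans (add_le_add ?_ ?_)
      · rw [norm_mul, Real.norm_of_nonneg (cutoff_nonneg _ _)]
        have h1 := abs_nlapIter_le hRs m y
        have h2 := hCb (2 * m) le_rfl y hy1
        rw [Nat.sub_self, pow_zero, mul_one] at h2
        calc _ ≤ 1 * ((n : ℝ) ^ m * C) := by
              refine mul_le_mul (cutoff_le_one _ _) (h1.trans ?_) (norm_nonneg _) zero_le_one
              gcongr
          _ = _ := one_mul _
      · refine (abs_nlapIter_le (hχR k) m y).trans ?_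
        gcongr
        refine (norm_iteratedFDeriv_mul_le (contDiff_infty.1 (hχs k) (2 * m))
          (contDiff_infty.1 hRs (2 * m)) y le_rfl).trans
          (Finset.sum_le_sum fun i hi => ?_)
        have hi' : i ≤ 2 * m := Nat.lt_succ_iff.1 (Finset.mem_range.1 hi)
        have h3 := hCb (2 * m - i) (by omega) y hy1
        rw [Nat.sub_sub_self hi'] at h3
        have h4 : (r k)⁻¹ ^ i * ‖y‖ ^ i ≤ 1 := by
          rw [← mul_pow]
          refine pow_le_one₀ (by have := hr0 k; positivity) ?_
          rw [inv_mul_le_iff₀ (hr0 k), mul_one]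
          exact h
        calc _ ≤ ((2 * m).choose i : ℝ) * (D * (r k)⁻¹ ^ i) * (C * ‖y‖ ^ i) := by
              gcongr
              · have := hr0 k; positivity
              · exact hDb i hi' (r k) (hr0 k) y h
          _ = ((2 * m).choose i : ℝ) * D * C * ((r k)⁻¹ ^ i * ‖y‖ ^ i) := by ring
          _ ≤ ((2 * m).choose i : ℝ) * D * C * 1 := by gcongr
          _ = _ := mul_one _
  have hlim : Filter.Tendsto (fun k => ∫ y, w y * B k y) Filter.atTop (nhds 0) := by
    rw [← integral_zero E ℝ (μ := volume)]
    refine tendsto_integral_filter_of_dominated_convergence (fun y => ‖w y‖ * M)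
      (.of_forall fun k => hwi.aestronglyMeasurable.mul (hBc k).aestronglyMeasurable) ?_
      (hwi.norm.mul_const M) ?_
    · filter_upwards [hr.eventually (ge_mem_nhds one_pos)] with k hk
      refine .of_forall fun y => ?_
      rw [norm_mul]
      exact mul_le_mul_of_nonneg_left (hBb k y hk) (norm_nonneg _)
    · filter_upwards [Measure.ae_ne (volume : Measure E) 0] with y hy
      refine tendsto_const_nhds.congr' ?_
      filter_upwards [hr.eventually (gt_mem_nhds (norm_pos_iff.2 hy))] with k hk
      rw [hB0 k y hk, mul_zero]
  refine hlim.congr' ?_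
  filter_upwards [hr.eventually (gt_mem_nhds (half_pos hx'))] with k hk
  have hVc : HasCompactSupport fun y => w y * cutoff (r k) y := hwc.mul_right
  have hGc : HasCompactSupport fun y => nlapIter m w y * cutoff (r k) y :=
    (hwc.nlapIter m).mul_right
  have hG : Continuous fun y => nlapIter m w y * cutoff (r k) y :=
    hgcont.continuous_mul_of_tsupport_subset hU (hχs k).continuous (tsupport_cutoff_subset (hr0 k))
  have i1 := integral_mul_nlapIter isOpen_univ m (hV k).contDiffOn (contDiff_infty.1 hRs _)
    (subset_univ _) (.inl hVc)
  have hsupp : tsupport (fun y => cutoff (r k) y * R y) ⊆ ({0}ᶜ : Set E) :=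
    (tsupport_mul_subset_left).trans (tsupport_cutoff_subset (hr0 k))
  have i2 := integral_mul_nlapIter hU m hw (contDiff_infty.1 (hχR k) _) hsupp (.inl hwc)
  have e1 : ∀ y, taylorRem (2 * m) (fundSol m n c) x (-y) *
      (nlapIter m (fun y => w y * cutoff (r k) y) y - nlapIter m w y * cutoff (r k) y) =
      nlapIter m (fun y => w y * cutoff (r k) y) y * R y -
        nlapIter m w y * (cutoff (r k) y * R y) := by
    intro y
    rcases lt_or_ge (r k) ‖y‖ with h | h
    · have h1 : (fun y => w y * cutoff (r k) y) =ᶠ[nhds y] w := by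
        filter_upwards [(isOpen_lt continuous_const continuous_norm).mem_nhds h] with z hz
        rw [cutoff_eq_one (hr0 k) (le_of_lt hz), mul_one]
      rw [(nlapIter_congr m h1).eq_of_nhds, cutoff_eq_one (hr0 k) h.le]
      ring
    · rw [taylorRem_congr (2 * m) hx hFφ (h.trans hk.le)]
      ring
  simp only [e1]
  have j1 : Integrable fun y => nlapIter m (fun y => w y * cutoff (r k) y) y * R y :=
    ((hV k).continuous_nlapIter.mul hRs.continuous).integrable_of_hasCompactSupport
      (hVc.nlapIter m).mul_right
  have j2 : Integrable fun y => nlapIter m w y * (cutoff (r k) y * R y) := by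
    refine ((hG.mul hRs.continuous).integrable_of_hasCompactSupport hGc.mul_right).congr
      (.of_forall fun y => ?_)
    simp only [Pi.mul_apply]
    ring
  have j3 : Integrable fun y => w y * cutoff (r k) y * nlapIter m R y :=
    Continuous.integrable_of_hasCompactSupport
      ((hV k).continuous.mul (contDiff_infty.1 hRs _).continuous_nlapIter) hVc.mul_right
  have j4 : Integrable fun y => w y * nlapIter m (fun y => cutoff (r k) y * R y) y :=
    (hw.continuousOn.continuous_mul_of_tsupport_subset hU
      (contDiff_infty.1 (hχR k) _).continuous_nlapIter
      ((tsupport_nlapIter_subset m _).trans hsupp)).integrable_of_hasCompactSupport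
      (.mul_of_or (.inl hwc))
  rw [integral_sub j1 j2, ← i1, ← i2, ← integral_sub j3 j4]
  refine integral_congr_ae (.of_forall fun y => ?_)
  simp only [hB]
  ring

/-- Representation of compactly supported integrable functions that are regular off the origin. -/
lemma IsFundConst.exists_representation {m s : ℕ} {c : ℝ} (hc : IsFundConst m n c) (hm : 0 < m)
    (hn : 2 * m ≤ n) (hs : s ≤ 2 * m - 1) {w : E → ℝ}
    (hw : ContDiffOn ℝ (2 * m : ℕ) w {0}ᶜ) (hwc : HasCompactSupport w) (hwi : Integrable w)
    (hgs : Integrable fun y => ‖y‖ ^ s * nlapIter m w y) :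
    ∃ a : (Fin n → ℕ) → ℝ, ∀ x, x ≠ 0 →
      w x = (∫ y, psiFun m n s c x y * nlapIter m w y) +
        ∑ β ∈ degLE n (2 * m - 1), a β * mderiv β (fundSol m n c) x := by
  have : Nonempty (Fin n) := ⟨⟨0, by omega⟩⟩
  have hU : IsOpen ({0}ᶜ : Set E) := isOpen_compl_singleton
  have hφ := locallyIntegrable_fundSol hm hn c
  have hgcont : ContinuousOn (nlapIter m w) {0}ᶜ := hw.continuousOn_nlapIter hU
  set r : ℕ → ℝ := fun k => 1 / ((k : ℝ) + 1) with hr_def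
  have hr0 : ∀ k, 0 < r k := fun k => by simp only [hr_def]; positivity
  have hr : Filter.Tendsto r Filter.atTop (nhds 0) := tendsto_one_div_add_atTop_nhds_zero_nat
  set G : ℕ → E → ℝ := fun k y => nlapIter m w y * cutoff (r k) y with hG_def
  set V : ℕ → E → ℝ := fun k y => w y * cutoff (r k) y with hV_def
  have hV : ∀ k, ContDiff ℝ (2 * m : ℕ) (V k) := fun k =>
    hw.contDiff_mul_of_tsupport_subset hU (contDiff_cutoff (r k) (k := (2 * m : ℕ)))
      (tsupport_cutoff_subset (hr0 k))
  have hVc : ∀ k, HasCompactSupport (V k) := fun k => hwc.mul_right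
  have hG : ∀ k, Continuous (G k) := fun k =>
    hgcont.continuous_mul_of_tsupport_subset hU (contDiff_cutoff (r k) (k := 0)).continuous
      (tsupport_cutoff_subset (hr0 k))
  have hGc : ∀ k, HasCompactSupport (G k) := fun k => (hwc.nlapIter m).mul_right
  have hE : ∀ k, Continuous fun y => nlapIter m (V k) y - G k y := fun k =>
    (hV k).continuous_nlapIter.sub (hG k)
  have hEc : ∀ k, HasCompactSupport fun y => nlapIter m (V k) y - G k y := fun k =>
    ((hVc k).nlapIter m).sub (hGc k)
  set T := degLE n (2 * m - 1) with hT
  have hT2 : degLT n (2 * m) = T := by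
    ext β
    rw [hT, mem_degLT, mem_degLE]
    omega
  have hTs : degLT n s ⊆ T := fun β hβ => by
    rw [mem_degLT] at hβ
    rw [hT, mem_degLE]
    omega
  set a : ℕ → (Fin n → ℕ) → ℝ := fun k β =>
    (∫ y, monom β (-y) * (nlapIter m (V k) y - G k y)) +
      if β ∈ degLT n s then ∫ y, monom β (-y) * G k y else 0 with ha
  have hrep : ∀ k x, r k ≤ ‖x‖ → ∑ β ∈ T, a k β * mderiv β (fundSol m n c) x =
      w x - (∫ y, psiFun m n s c x y * G k y) -
        ∫ y, taylorRem (2 * m) (fundSol m n c) x (-y) * (nlapIter m (V k) y - G k y) := by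
    intro k x hx
    have h1 : V k x = w x := by simp only [hV_def, cutoff_eq_one (hr0 k) hx, mul_one]
    have h2 := hc.integral_eq hm hn (hV k) (hVc k) x
    have h3 : ∫ y, fundSol m n c (x - y) * nlapIter m (V k) y =
        (∫ y, fundSol m n c (x - y) * G k y) +
          ∫ y, fundSol m n c (x - y) * (nlapIter m (V k) y - G k y) := by
      rw [← integral_add (integrable_comp_sub_mul hφ (hG k) (hGc k) x)
        (integrable_comp_sub_mul hφ (hE k) (hEc k) x)]
      refine integral_congr_ae (.of_forall fun y => ?_)
      simp only
      ring
    rw [integral_comp_sub_mul_eq hφ (hG k) (hGc k) s x,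
      integral_comp_sub_mul_eq hφ (hE k) (hEc k) (2 * m) x, hT2, h2, h1] at h3
    simp only [psiFun_eq_taylorRem]
    rw [h3]
    simp only [ha, add_mul, Finset.sum_add_distrib, ite_mul, zero_mul]
    rw [← Finset.sum_filter, Finset.filter_mem_eq_inter, Finset.inter_eq_right.2 hTs]
    ring
  have hlim : ∀ x : {x : E // x ≠ 0}, Filter.Tendsto
      (fun k => ∑ β ∈ T, a k β * mderiv β (fundSol m n c) x.1) Filter.atTop
      (nhds (w x.1 - (∫ y, psiFun m n s c x.1 y * nlapIter m w y) - 0)) := by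
    rintro ⟨x, hx⟩
    have h1 : Filter.Tendsto (fun k => ∫ y, psiFun m n s c x y * G k y) Filter.atTop
        (nhds (∫ y, psiFun m n s c x y * nlapIter m w y)) := by
      have hintegrable := integrable_psiFun_mul (c := c) hm hn hgcont (hwc.nlapIter m) hgs hx
      refine tendsto_integral_of_dominated_convergence
        (fun y => ‖psiFun m n s c x y * nlapIter m w y‖) (fun k => ?_) hintegrable.norm
        (fun k => ?_) ?_
      · simp only [psiFun_eq_taylorRem]
        exact (integrable_taylorRem_mul hφ (hG k) (hGc k) s x).aestronglyMeasurable
      · refine .of_forall fun y => ?_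
        simp only [hG_def]
        rw [← mul_assoc, norm_mul _ (cutoff (r k) y), Real.norm_of_nonneg (cutoff_nonneg _ _)]
        exact mul_le_of_le_one_right (norm_nonneg _) (cutoff_le_one _ _)
      · filter_upwards [Measure.ae_ne (volume : Measure E) 0] with y hy
        refine tendsto_const_nhds.congr' ?_
        filter_upwards [hr.eventually (gt_mem_nhds (norm_pos_iff.2 hy))] with k hk
        simp only [hG_def]
        rw [cutoff_eq_one (hr0 k) hk.le, mul_one]
    refine ((tendsto_const_nhds.sub h1).sub
      (tendsto_integral_taylorRem_error (c := c) hm hn hw hwc hwi hx hr0 hr)).congr' ?_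
    filter_upwards [hr.eventually (gt_mem_nhds (norm_pos_iff.2 hx))] with k hk
    exact (hrep k x hk.le).symm
  obtain ⟨b, hb⟩ := exists_eq_sum_of_tendsto T
    (fun β (x : {x : E // x ≠ 0}) => mderiv β (fundSol m n c) x.1) a _ hlim
  refine ⟨b, fun x hx => ?_⟩
  have := hb ⟨x, hx⟩
  simp only at this
  linarith

end Representation

section Potential

open scoped Convolution

variable {n : ℕ}

local notation "E" => EuclideanSpace ℝ (Fin n)

/-- A bump function at the origin equal to `1` on the ball of radius `ρ` and supported in the
closed ball of radius `R`. -/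
def centerBump (n : ℕ) {ρ R : ℝ} (hρ : 0 < ρ) (hR : ρ < R) :
    ContDiffBump (0 : EuclideanSpace ℝ (Fin n)) := ⟨ρ, R, hρ, hR⟩

lemma exists_contDiff_hasCompactSupport_eq_fundSol (m n : ℕ) (c : ℝ) {ε R : ℝ} (hε : 0 < ε)
    (hR : 0 < R) :
    ∃ F : EuclideanSpace ℝ (Fin n) → ℝ, ContDiff ℝ (⊤ : ℕ∞) F ∧ HasCompactSupport F ∧
      ∀ y, ε ≤ ‖y‖ → ‖y‖ ≤ R → F y = fundSol m n c y := by
  obtain ⟨F, hF, hFφ⟩ := exists_contDiff_eq_fundSol m n c hε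
  refine ⟨fun y => F y * centerBump n hR (lt_add_one R) y,
    hF.mul (centerBump n hR (lt_add_one R)).contDiff,
    (centerBump n hR (lt_add_one R)).hasCompactSupport.mul_left, fun y h1 h2 => ?_⟩
  simp only
  rw [hFφ y h1, (centerBump n hR (lt_add_one R)).one_of_mem_closedBall, mul_one]
  simpa [centerBump] using h2

lemma IsFundConst.exists_local_potential {m : ℕ} {c : ℝ} (hc : IsFundConst m n c) {q : E → ℝ}
    {ρ : ℝ} (hq : Integrable q) (hq0 : ∀ y, ‖y‖ < ρ → q y = 0) (hq1 : ∀ y, 1 ≤ ‖y‖ → q y = 0)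
    {x₀ : E} (hx₀ : ‖x₀‖ < ρ) :
    Integrable (fun y => fundSol m n c (x₀ - y) * q y) ∧
      ContDiffAt ℝ (⊤ : ℕ∞) (fun x => ∫ y, fundSol m n c (x - y) * q y) x₀ ∧
      nlapIter m (fun x => ∫ y, fundSol m n c (x - y) * q y) x₀ = 0 := by
  set ε := (ρ - ‖x₀‖) / 2 with hε_def
  have hε : 0 < ε := by linarith
  have hρ : 0 < ρ := (norm_nonneg _).trans_lt hx₀
  obtain ⟨F, hF, hFc, hFφ⟩ := exists_contDiff_hasCompactSupport_eq_fundSol m n c hε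
    (show 0 < ρ + 2 by linarith)
  have hdist : ∀ x y, ‖x‖ < ‖x₀‖ + ε → q y ≠ 0 → ε < ‖x - y‖ ∧ ‖x - y‖ < ρ + 2 := by
    intro x y hx hy
    have h1 : ρ ≤ ‖y‖ := not_lt.1 fun h => hy (hq0 y h)
    have h2 : ‖y‖ < 1 := not_le.1 fun h => hy (hq1 y h)
    have h3 := norm_sub_norm_le y x
    rw [norm_sub_rev] at h3
    have h4 := norm_sub_le x y
    constructor <;> linarith
  have hmul : ∀ x, ‖x‖ < ‖x₀‖ + ε → ∀ y, fundSol m n c (x - y) * q y = q y * F (x - y) := by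
    intro x hx y
    by_cases hy : q y = 0
    · rw [hy, mul_zero, zero_mul]
    · obtain ⟨h1, h2⟩ := hdist x y hx hy
      rw [hFφ _ h1.le h2.le, mul_comm]
  have hx₀' : ‖x₀‖ < ‖x₀‖ + ε := by linarith
  have hev : (fun x => ∫ y, fundSol m n c (x - y) * q y) =ᶠ[nhds x₀]
      q ⋆[ContinuousLinearMap.lsmul ℝ ℝ, volume] F := by
    filter_upwards [(isOpen_lt continuous_norm continuous_const).mem_nhds hx₀'] with x hx
    exact integral_congr_ae (.of_forall (hmul x hx))
  refine ⟨?_, ?_, ?_⟩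
  · have h : Integrable fun y => q y * F (x₀ - y) :=
      hFc.convolutionExists_right (ContinuousLinearMap.lsmul ℝ ℝ) hq.locallyIntegrable
        hF.continuous x₀
    exact h.congr (.of_forall fun y => (hmul x₀ hx₀' y).symm)
  · exact (hFc.contDiff_convolution_right _ hq.locallyIntegrable hF).contDiffAt.congr_of_eventuallyEq
      hev
  · rw [(nlapIter_congr m hev).eq_of_nhds,
      nlapIter_convolution m hq.locallyIntegrable (contDiff_infty.1 hF _) hFc, convolution_def,
      ← integral_zero E ℝ (μ := volume)]
    refine integral_congr_ae (.of_forall fun y => ?_)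
    by_cases hy : q y = 0
    · simp [hy]
    · obtain ⟨h1, h2⟩ := hdist x₀ y hx₀' hy
      have h3 : F =ᶠ[nhds (x₀ - y)] fundSol m n c := by
        filter_upwards [(isOpen_lt continuous_const continuous_norm).mem_nhds h1,
          (isOpen_lt continuous_norm continuous_const).mem_nhds h2] with z h4 h5
        exact hFφ z (le_of_lt h4) (le_of_lt h5)
      have h4 : nlapIter m F (x₀ - y) = 0 := by
        rw [(nlapIter_congr m h3).eq_of_nhds]
        exact hc.nlapIter_fundSol (norm_pos_iff.1 (hε.trans h1))
      simp [h4]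

lemma nlapIter_add {U : Set E} (hU : IsOpen U) (m : ℕ) {f g : E → ℝ}
    (hf : ContDiffOn ℝ (2 * m : ℕ) f U) (hg : ContDiffOn ℝ (2 * m : ℕ) g U) {x : E} (hx : x ∈ U) :
    nlapIter m (fun y => f y + g y) x = nlapIter m f x + nlapIter m g x := by
  induction m generalizing f g x with
  | zero => rfl
  | succ m ih =>
    have h2 : ((2 : ℕ) : WithTop ℕ∞) ≤ (2 * (m + 1) : ℕ) := by exact_mod_cast (by omega)
    have hf2 : ContDiffOn ℝ 2 f U := hf.of_le h2
    have hg2 : ContDiffOn ℝ 2 g U := hg.of_le h2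
    have h1 : ∀ {f g : E → ℝ}, ContDiffOn ℝ 1 f U → ContDiffOn ℝ 1 g U → ∀ (i : Fin n), ∀ y ∈ U,
        pderiv1 i (fun y => f y + g y) y = pderiv1 i f y + pderiv1 i g y := by
      intro f g hf hg i y hy
      rw [pderiv1, fderiv_fun_add
        ((hf.contDiffAt (hU.mem_nhds hy)).differentiableAt (by norm_num))
        ((hg.contDiffAt (hU.mem_nhds hy)).differentiableAt (by norm_num))]
      rfl
    have h3 : ∀ y ∈ U, nlap (fun y => f y + g y) y = nlap f y + nlap g y := by
      intro y hy
      have h4 : ∀ i, pderiv1 i (pderiv1 i (fun y => f y + g y)) y =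
          pderiv1 i (pderiv1 i f) y + pderiv1 i (pderiv1 i g) y := by
        intro i
        rw [← h1 (hf2.pderiv1 hU i (by norm_num)) (hg2.pderiv1 hU i (by norm_num)) i y hy]
        refine (pderiv1_congr i ?_).eq_of_nhds
        filter_upwards [hU.mem_nhds hy] with z hz
        exact h1 (hf2.of_le (by norm_num)) (hg2.of_le (by norm_num)) i z hz
      simp only [nlap, lap, h4, Finset.sum_add_distrib, neg_add]
    have h5 : nlap (fun y => f y + g y) =ᶠ[nhds x] fun y => nlap f y + nlap g y := by
      filter_upwards [hU.mem_nhds hx] with y hy using h3 y hy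
    rw [nlapIter_succ, (nlapIter_congr m h5).eq_of_nhds]
    exact ih (f := nlap f) (g := nlap g)
      (hf.nlapIter (m := 1) hU (by omega)) (hg.nlapIter (m := 1) hU (by omega)) hx

end Potential

section Assembly

variable {n : ℕ}

local notation "E" => EuclideanSpace ℝ (Fin n)

lemma ContDiffOn.mul_contDiffOn_compl_singleton {k : WithTop ℕ∞} {u θ : E → ℝ} {U : Set E}
    (hU : IsOpen U) (hu : ContDiffOn ℝ k u (U \ {0})) (hθ : ContDiff ℝ k θ) (hθU : tsupport θ ⊆ U) :
    ContDiffOn ℝ k (fun x => u x * θ x) {0}ᶜ := by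
  intro x hx
  refine ContDiffAt.contDiffWithinAt ?_
  by_cases hxθ : x ∈ tsupport θ
  · exact (hu.contDiffAt ((hU.sdiff isClosed_singleton).mem_nhds ⟨hθU hxθ, hx⟩)).mul hθ.contDiffAt
  · refine (contDiffAt_const (c := (0 : ℝ))).congr_of_eventuallyEq ?_
    filter_upwards [notMem_tsupport_iff_eventuallyEq.1 hxθ] with y hy
    simp [hy]

/-- The representation on a smaller ball, with the regular part as a potential of a density
supported away from that ball. -/
lemma IsFundConst.exists_representation_on_ball {m s : ℕ} {c : ℝ} (hc : IsFundConst m n c)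
    (hm : 0 < m) (hn : 2 * m ≤ n) (hs : s ≤ 2 * m - 1) {u f : E → ℝ} (hf : Measurable f)
    (hu : ContDiffOn ℝ (2 * m : ℕ) u (ball (0 : E) 1 \ {0}))
    (heq : ∀ x ∈ ball (0 : E) 1 \ {0}, nlapIter m u x = f x)
    (hfint : IntegrableOn (fun x => ‖x‖ ^ s * |f x|) (ball (0 : E) 1 \ {0}))
    (huplus : IntegrableOn (fun x => max (u x) 0) (ball (0 : E) 1 \ {0})) :
    ∃ b : (Fin n → ℕ) → ℝ, ∀ ρ, 1 / 2 ≤ ρ → ρ < 1 → ∃ q : E → ℝ, Integrable q ∧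
      (∀ y, ‖y‖ < ρ → q y = 0) ∧ (∀ y, 1 ≤ ‖y‖ → q y = 0) ∧ ∀ x, ‖x‖ < ρ → x ≠ 0 →
        u x = NFun m n s c f x + (∫ y, fundSol m n c (x - y) * q y) +
          ∑ β ∈ degLE n (2 * m - 1), b β * mderiv β (fundSol m n c) x := by
  have : Nonempty (Fin n) := ⟨⟨0, by omega⟩⟩
  have hU : IsOpen ({0}ᶜ : Set E) := isOpen_compl_singleton
  have hB : IsOpen (ball (0 : E) 1 \ {0}) := isOpen_ball.sdiff isClosed_singleton
  have hφ := locallyIntegrable_fundSol hm hn c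
  set F : E → ℝ := (ball (0 : E) 1 \ {0}).indicator f with hF_def
  have hFm : Measurable F := hf.indicator hB.measurableSet
  have hFs : Integrable fun y => ‖y‖ ^ s * F y := by
    refine (hfint.integrable_indicator hB.measurableSet).mono
      (((measurable_norm.pow_const s).mul hFm).aestronglyMeasurable) (.of_forall fun y => ?_)
    by_cases hy : y ∈ ball (0 : E) 1 \ {0}
    · simp [hF_def, indicator_of_mem hy]
    · simp [hF_def, indicator_of_notMem hy]
  have hFf : ∀ y, ‖y‖ < 1 → y ≠ 0 → F y = f y := fun y h1 h2 =>
    indicator_of_mem (show y ∈ ball (0 : E) 1 \ {0} from ⟨by simpa using h1, h2⟩) _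
  have hF1 : ∀ y, 1 ≤ ‖y‖ → F y = 0 := fun y h =>
    indicator_of_notMem (fun h' => absurd h'.1 (by simpa using h)) _
  have hbump : ∀ {ρ : ℝ} (h0 : 0 < ρ) (h1 : ρ < (1 + ρ) / 2), ρ < 1 →
      tsupport (centerBump n h0 h1) ⊆ ball (0 : E) 1 := by
    intro ρ h0 h1 hρ
    rw [(centerBump n h0 h1).tsupport_eq]
    exact closedBall_subset_ball (show (1 + ρ) / 2 < 1 by linarith)
  have hone : ∀ {ρ : ℝ} (h0 : 0 < ρ) (h1 : ρ < (1 + ρ) / 2) {y : E}, ‖y‖ < ρ →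
      centerBump n h0 h1 y = 1 := fun h0 h1 y hy =>
    (centerBump n h0 h1).one_of_mem_closedBall (mem_closedBall_zero_iff.2 (le_of_lt hy))
  set θ := centerBump n (ρ := 1 / 2) (R := (1 + 1 / 2) / 2) (by norm_num) (by norm_num) with hθ_def
  have hθt : tsupport θ ⊆ ball (0 : E) 1 := hbump _ _ (by norm_num)
  set w : E → ℝ := fun y => u y * θ y with hw_def
  set g : E → ℝ := nlapIter m w with hg_def
  have hw : ContDiffOn ℝ (2 * m : ℕ) w {0}ᶜ :=
    hu.mul_contDiffOn_compl_singleton isOpen_ball θ.contDiff hθt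
  have hwc : HasCompactSupport w := θ.hasCompactSupport.mul_left
  have hgcont : ContinuousOn g {0}ᶜ := hw.continuousOn_nlapIter hU
  have hgc : HasCompactSupport g := hwc.nlapIter m
  have hgt : tsupport g ⊆ ball (0 : E) 1 :=
    (tsupport_nlapIter_subset m w).trans (tsupport_mul_subset_right.trans hθt)
  have hg1 : ∀ y, 1 ≤ ‖y‖ → g y = 0 := fun y hy => by
    by_contra h
    exact absurd (hgt (subset_tsupport _ h)) (by simpa using hy)
  have hgm : AEStronglyMeasurable g volume := by
    have h := hgcont.aestronglyMeasurable (μ := volume) hU.measurableSet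
    rwa [restrict_compl_singleton] at h
  have hgf : ∀ y, ‖y‖ < 1 / 2 → y ≠ 0 → g y = F y := by
    intro y hy hy0
    rw [hFf y (by linarith) hy0, ← heq y ⟨by simpa using (by linarith : ‖y‖ < 1), hy0⟩]
    refine (nlapIter_congr m ?_).eq_of_nhds
    filter_upwards [(isOpen_lt continuous_norm continuous_const).mem_nhds hy] with z hz
    simp only [hw_def, hθ_def]
    rw [hone _ _ hz, mul_one]
  have hgs : Integrable fun y => ‖y‖ ^ s * g y := by
    have hG : Continuous fun y => g y * cutoff (1 / 2) y :=
      hgcont.continuous_mul_of_tsupport_subset hU (contDiff_cutoff (1 / 2) (k := 0)).continuous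
        (tsupport_cutoff_subset (by norm_num))
    have hGi : Integrable fun y => ‖y‖ ^ s * (g y * cutoff (1 / 2) y) :=
      ((continuous_norm.pow s).mul hG).integrable_of_hasCompactSupport
        (HasCompactSupport.mul_left hgc.mul_right)
    refine (hFs.norm.add hGi.norm).mono'
      ((measurable_norm.pow_const s).aestronglyMeasurable.mul hgm) ?_
    filter_upwards [Measure.ae_ne (volume : Measure E) 0] with y hy
    simp only [Pi.add_apply]
    rcases lt_or_ge ‖y‖ (1 / 2) with h | h
    · rw [hgf y h hy]
      exact le_add_of_nonneg_right (norm_nonneg _)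
    · rw [cutoff_eq_one (by norm_num) h, mul_one]
      exact le_add_of_nonneg_left (norm_nonneg _)
  have hg2m : Integrable fun y => ‖y‖ ^ (2 * m) * g y := by
    refine hgs.norm.mono' ((measurable_norm.pow_const _).aestronglyMeasurable.mul hgm)
      (.of_forall fun y => ?_)
    rcases lt_or_ge ‖y‖ 1 with h | h
    · rw [norm_mul, norm_mul, norm_pow, norm_pow, norm_norm]
      exact mul_le_mul_of_nonneg_right
        (pow_le_pow_of_le_one (norm_nonneg _) h.le (by omega)) (norm_nonneg _)
    · simp [hg1 y h]
  have hplus : Integrable fun y => max (w y) 0 := by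
    have hwm : AEStronglyMeasurable w volume := by
      have h := hw.continuousOn.aestronglyMeasurable (μ := volume) hU.measurableSet
      rwa [restrict_compl_singleton] at h
    refine (huplus.integrable_indicator hB.measurableSet).mono'
      (hwm.sup aestronglyMeasurable_const) ?_
    filter_upwards [Measure.ae_ne (volume : Measure E) 0] with y hy
    rw [Real.norm_of_nonneg (le_max_right _ _)]
    by_cases h : y ∈ ball (0 : E) 1
    · rw [indicator_of_mem (show y ∈ ball (0 : E) 1 \ {0} from ⟨h, hy⟩)]
      refine max_le ?_ (le_max_right _ _)
      calc w y ≤ max (u y) 0 * θ y := mul_le_mul_of_nonneg_right (le_max_left _ _) θ.nonneg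
        _ ≤ _ := mul_le_of_le_one_right (le_max_right _ _) θ.le_one
    · have h0 : θ y = 0 := by
        by_contra h'
        exact h (hθt (subset_tsupport _ h'))
      simp only [hw_def, h0, mul_zero, max_self]
      exact indicator_nonneg (fun _ _ => le_max_right _ _) _
  have hwi := integrable_of_integrable_max_zero hm hn hw hwc hg2m hplus
  obtain ⟨a, ha⟩ := hc.exists_representation hm hn hs hw hwc hwi hgs
  set d : E → ℝ := fun y => F y - g y with hd_def
  have hdm : AEStronglyMeasurable d volume := hFm.aestronglyMeasurable.sub hgm
  have hd1 : ∀ y, 1 ≤ ‖y‖ → d y = 0 := fun y hy => by simp [hd_def, hF1 y hy, hg1 y hy]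
  have hd : Integrable d := by
    refine (((hFs.sub hgs).norm).const_mul (2 ^ s)).mono' hdm ?_
    filter_upwards [Measure.ae_ne (volume : Measure E) 0] with y hy
    simp only [Pi.sub_apply]
    rcases lt_or_ge ‖y‖ (1 / 2) with h | h
    · simp only [hd_def, hgf y h hy, sub_self, norm_zero]
      positivity
    · rw [← mul_sub, norm_mul, norm_pow, norm_norm, ← mul_assoc, ← mul_pow]
      exact le_mul_of_one_le_left (norm_nonneg _) (one_le_pow₀ (by linarith))
  have hdmon : ∀ β : Fin n → ℕ, Integrable fun y => monom β (-y) * d y := by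
    intro β
    have hmc : Continuous fun y : E => monom β (-y) :=
      (contDiff_monom (k := 0) β).continuous.comp continuous_neg
    obtain ⟨C, hC⟩ := (isCompact_closedBall (0 : E) 1).exists_bound_of_continuousOn
      hmc.continuousOn
    refine (hd.norm.const_mul C).mono' (hmc.aestronglyMeasurable.mul hdm) (.of_forall fun y => ?_)
    rcases lt_or_ge ‖y‖ 1 with h | h
    · rw [norm_mul]
      exact mul_le_mul_of_nonneg_right (hC y (by simpa using h.le)) (norm_nonneg _)
    · simp [hd1 y h]
  set T := degLE n (2 * m - 1) with hT
  have hTs : degLT n s ⊆ T := fun β hβ => by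
    rw [mem_degLT] at hβ
    rw [hT, mem_degLE]
    omega
  refine ⟨fun β => a β + if β ∈ degLT n s then ∫ y, monom β (-y) * d y else 0,
    fun ρ hρ hρ1 => ?_⟩
  have hρ0 : 0 < ρ := by linarith
  set θ' := centerBump n (R := (1 + ρ) / 2) hρ0 (by linarith) with hθ'_def
  have hθt' : tsupport θ' ⊆ ball (0 : E) 1 := hbump _ _ hρ1
  set v : E → ℝ := fun y => u y * (θ' y - θ y) with hv_def
  have hsubt : tsupport (fun y => θ' y - θ y) ⊆ ball (0 : E) 1 \ {0} := by
    refine subset_sdiff.2 ⟨(tsupport_sub _ _).trans (union_subset hθt' hθt), ?_⟩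
    rw [disjoint_singleton_right]
    refine notMem_tsupport_iff_eventuallyEq.2 ?_
    filter_upwards [ball_mem_nhds (0 : E) (show (0 : ℝ) < 1 / 2 by norm_num)] with y hy
    rw [mem_ball_zero_iff] at hy
    simp only [hθ'_def, hθ_def, Pi.zero_apply]
    rw [hone _ _ hy, hone _ _ (hy.trans_le hρ), sub_self]
  have hv : ContDiff ℝ (2 * m : ℕ) v :=
    hu.contDiff_mul_of_tsupport_subset hB (θ'.contDiff.sub θ.contDiff) hsubt
  have hvc : HasCompactSupport v :=
    (θ'.hasCompactSupport.sub θ.hasCompactSupport).mul_left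
  have hVc := hv.continuous_nlapIter (m := m)
  have hVs := hvc.nlapIter m
  have hV1 : ∀ y, 1 ≤ ‖y‖ → nlapIter m v y = 0 := fun y hy => by
    by_contra h
    exact absurd (hsubt (tsupport_mul_subset_right
      (tsupport_nlapIter_subset m v (subset_tsupport _ h)))).1 (by simpa using hy)
  have hVd : ∀ y, ‖y‖ < ρ → y ≠ 0 → nlapIter m v y = d y := by
    intro y hy hy0
    have h1 := nlapIter_add hU m hw hv.contDiffOn (x := y) hy0
    have h2 : (fun y => w y + v y) =ᶠ[nhds y] u := by
      filter_upwards [(isOpen_lt continuous_norm continuous_const).mem_nhds hy] with z hz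
      simp only [hw_def, hv_def, hθ'_def]
      rw [hone _ _ hz]
      ring
    rw [(nlapIter_congr m h2).eq_of_nhds,
      heq y ⟨by simpa using hy.trans hρ1, hy0⟩, ← hFf y (hy.trans hρ1) hy0] at h1
    simp only [hd_def, h1, hg_def]
    ring
  set q : E → ℝ := (ball (0 : E) ρ)ᶜ.indicator fun y => nlapIter m v y - d y with hq_def
  have hq : Integrable q :=
    ((hVc.integrable_of_hasCompactSupport hVs).sub hd).indicator measurableSet_ball.compl
  have hq0 : ∀ y, ‖y‖ < ρ → q y = 0 := fun y hy =>
    indicator_of_notMem (by simpa using hy) _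
  have hq1 : ∀ y, 1 ≤ ‖y‖ → q y = 0 := fun y hy => by
    by_cases h : y ∈ (ball (0 : E) ρ)ᶜ
    · rw [hq_def, indicator_of_mem h, hV1 y hy, hd1 y hy, sub_zero]
    · exact indicator_of_notMem h _
  have hdq : ∀ y, y ≠ 0 → d y = nlapIter m v y - q y := by
    intro y hy
    by_cases h : ‖y‖ < ρ
    · rw [hq0 y h, hVd y h hy, sub_zero]
    · rw [hq_def, indicator_of_mem (by simpa using h)]
      ring
  refine ⟨q, hq, hq0, hq1, fun x hx hx0 => ?_⟩
  have hux : u x = w x + v x := by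
    simp only [hw_def, hv_def, hθ'_def]
    rw [hone _ _ hx]
    ring
  have hiV := integrable_comp_sub_mul hφ hVc hVs x
  have hiq := (hc.exists_local_potential hq hq0 hq1 hx).1
  have hae : (fun y => fundSol m n c (x - y) * d y) =ᵐ[volume] fun y =>
      fundSol m n c (x - y) * nlapIter m v y - fundSol m n c (x - y) * q y := by
    filter_upwards [Measure.ae_ne (volume : Measure E) 0] with y hy
    rw [hdq y hy, mul_sub]
  have hid : Integrable fun y => fundSol m n c (x - y) * d y := (hiV.sub hiq).congr hae.symm
  have hsum : Integrable fun y =>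
      ∑ β ∈ degLT n s, monom β (-y) * d y * mderiv β (fundSol m n c) x :=
    integrable_finsetSum _ fun β _ => (hdmon β).mul_const _
  have hψd : ∀ y, psiFun m n s c x y * d y = fundSol m n c (x - y) * d y -
      ∑ β ∈ degLT n s, monom β (-y) * d y * mderiv β (fundSol m n c) x := by
    intro y
    rw [psiFun_eq_taylorRem, taylorRem, sub_mul, Finset.sum_mul, ← sub_eq_add_neg]
    congr 1
    exact Finset.sum_congr rfl fun β _ => by ring
  have hN : NFun m n s c f x = ∫ y, psiFun m n s c x y * F y := by
    rw [NFun, ← integral_indicator measurableSet_closedBall]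
    refine integral_congr_ae ?_
    have hsph : ∀ᵐ y : E, y ∉ sphere (0 : E) 1 :=
      measure_eq_zero_iff_ae_notMem.1 (Measure.addHaar_sphere volume 0 1)
    filter_upwards [Measure.ae_ne (volume : Measure E) 0, hsph] with y hy hy1
    rw [mem_sphere_zero_iff_norm] at hy1
    rcases lt_or_gt_of_ne hy1 with h | h
    · rw [indicator_of_mem (by simpa using h.le), hFf y h hy]
    · rw [indicator_of_notMem (by simpa using h), hF1 y h.le, mul_zero]
  have hN2 : ∫ y, psiFun m n s c x y * F y =
      (∫ y, psiFun m n s c x y * g y) + ∫ y, psiFun m n s c x y * d y := by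
    rw [← integral_add (integrable_psiFun_mul hm hn hgcont hgc hgs hx0)
      ((hid.sub hsum).congr (.of_forall fun y => (hψd y).symm))]
    refine integral_congr_ae (.of_forall fun y => ?_)
    simp only [hd_def]
    ring
  have hN3 : ∫ y, psiFun m n s c x y * d y = v x - (∫ y, fundSol m n c (x - y) * q y) -
      ∑ β ∈ degLT n s, (∫ y, monom β (-y) * d y) * mderiv β (fundSol m n c) x := by
    simp only [hψd]
    rw [integral_sub hid hsum, integral_congr_ae hae, integral_sub hiV hiq,
      hc.integral_eq hm hn hv hvc x, integral_finsetSum _ fun β _ => (hdmon β).mul_const _]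
    simp only [integral_mul_const]
  simp only [add_mul, Finset.sum_add_distrib, ite_mul, zero_mul]
  rw [← Finset.sum_filter, Finset.filter_mem_eq_inter, Finset.inter_eq_right.2 hTs, hN, hN2, hN3,
    hux, ha x hx0]
  ring

end Assembly

/-- representation of a solution of `(-Δ)^m u = f` on the punctured
unit ball, with `u⁺ ∈ L¹` and `∫ |x|^s |f| < ∞`, as `u = N + h + ∑ a_β D^β φ`. -/
theorem stmt_4 (m n s : ℕ) (hm : 0 < m) (hn : 2*m ≤ n) (hs : s ≤ 2*m - 1)
    (c : ℝ) (hc : 0 < c)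
    (hfund : ∀ η : EuclideanSpace ℝ (Fin n) → ℝ, ContDiff ℝ (⊤ : ℕ∞) η →
      HasCompactSupport η → ∫ x, fundSol m n c x * nlapIter m η x = η 0)
    (u f : EuclideanSpace ℝ (Fin n) → ℝ) (hf : Measurable f)
    (hu : ContDiffOn ℝ (2*m : ℕ) u (ball (0 : EuclideanSpace ℝ (Fin n)) 1 \ {0}))
    (heq : ∀ x ∈ ball (0 : EuclideanSpace ℝ (Fin n)) 1 \ {0}, nlapIter m u x = f x)
    (hfint : IntegrableOn (fun x => ‖x‖ ^ s * |f x|)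
      (ball (0 : EuclideanSpace ℝ (Fin n)) 1 \ {0}))
    (huplus : IntegrableOn (fun x => max (u x) 0)
      (ball (0 : EuclideanSpace ℝ (Fin n)) 1 \ {0})) :
    ∃ a : (Fin n → ℕ) → ℝ, ∃ h : EuclideanSpace ℝ (Fin n) → ℝ,
      ContDiffOn ℝ (⊤ : ℕ∞) h (ball (0 : EuclideanSpace ℝ (Fin n)) 1) ∧
      (∀ x ∈ ball (0 : EuclideanSpace ℝ (Fin n)) 1, nlapIter m h x = 0) ∧
      ∀ x ∈ ball (0 : EuclideanSpace ℝ (Fin n)) 1 \ {0},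
        u x = NFun m n s c f x + h x +
          ∑ β ∈ degLE n (2*m - 1), a β * mderiv β (fundSol m n c) x := by
  have hc' : IsFundConst m n c := hfund
  obtain ⟨b, hb⟩ := hc'.exists_representation_on_ball hm hn hs hf hu heq hfint huplus
  choose! q hqi hq0 hq1 hrep using hb
  set H : ℝ → EuclideanSpace ℝ (Fin n) → ℝ := fun ρ x => ∫ y, fundSol m n c (x - y) * q ρ y with hH
  have hloc : ∀ ρ, 1 / 2 ≤ ρ → ρ < 1 → ∀ x : EuclideanSpace ℝ (Fin n), ‖x‖ < ρ →
      ContDiffAt ℝ (⊤ : ℕ∞) (H ρ) x ∧ nlapIter m (H ρ) x = 0 := fun ρ h1 h2 x hx =>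
    (hc'.exists_local_potential (hqi ρ h1 h2) (hq0 ρ h1 h2) (hq1 ρ h1 h2) hx).2
  set h : EuclideanSpace ℝ (Fin n) → ℝ := fun x => if x = 0 then H (1 / 2) 0 else
    u x - NFun m n s c f x - ∑ β ∈ degLE n (2 * m - 1), b β * mderiv β (fundSol m n c) x with hh
  have hne : ∀ ρ, 1 / 2 ≤ ρ → ρ < 1 → ∀ x : EuclideanSpace ℝ (Fin n), ‖x‖ < ρ → x ≠ 0 →
      h x = H ρ x := by
    intro ρ h1 h2 x hx hx0
    simp only [hh, if_neg hx0, hH]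
    rw [hrep ρ h1 h2 x hx hx0]
    ring
  have hzero : ∀ ρ, 1 / 2 ≤ ρ → ρ < 1 → h 0 = H ρ 0 := by
    intro ρ h1 h2
    have : Nonempty (Fin n) := ⟨⟨0, by omega⟩⟩
    have hev : H (1 / 2) =ᶠ[nhdsWithin 0 {0}ᶜ] H ρ := by
      filter_upwards [self_mem_nhdsWithin, nhdsWithin_le_nhds
        (ball_mem_nhds (0 : EuclideanSpace ℝ (Fin n)) (show (0 : ℝ) < 1 / 2 by norm_num))]
        with x hx hx2
      rw [mem_ball_zero_iff] at hx2
      rw [← hne (1 / 2) le_rfl (by norm_num) x hx2 hx, hne ρ h1 h2 x (hx2.trans_le h1) hx]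
    have h3 := (hloc (1 / 2) le_rfl (by norm_num) 0 (by rw [norm_zero]; norm_num)).1.continuousAt
    have h4 := (hloc ρ h1 h2 0 (by rw [norm_zero]; linarith)).1.continuousAt
    have h5 := ((h3.eventuallyEq_nhds_iff_eventuallyEq_nhdsNE h4).1 hev).eq_of_nhds
    simpa only [hh, if_pos] using h5
  have hball : ∀ x ∈ ball (0 : EuclideanSpace ℝ (Fin n)) 1,
      ∃ ρ, 1 / 2 ≤ ρ ∧ ρ < 1 ∧ ‖x‖ < ρ ∧ h =ᶠ[nhds x] H ρ := by
    intro x hx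
    rw [mem_ball_zero_iff] at hx
    have h1 : ‖x‖ < (1 + ‖x‖) / 2 := by linarith
    have h2 : 1 / 2 ≤ (1 + ‖x‖) / 2 := by linarith [norm_nonneg x]
    refine ⟨(1 + ‖x‖) / 2, h2, by linarith, h1, ?_⟩
    filter_upwards [(isOpen_lt continuous_norm continuous_const).mem_nhds h1] with y hy
    rcases eq_or_ne y 0 with rfl | hy0
    · exact hzero _ h2 (by linarith)
    · exact hne _ h2 (by linarith) y hy hy0
  refine ⟨b, h, fun x hx => ?_, fun x hx => ?_, fun x hx => ?_⟩
  · obtain ⟨ρ, h1, h2, h3, h4⟩ := hball x hx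
    exact ((hloc ρ h1 h2 x h3).1.congr_of_eventuallyEq h4).contDiffWithinAt
  · obtain ⟨ρ, h1, h2, h3, h4⟩ := hball x hx
    rw [(nlapIter_congr m h4).eq_of_nhds, (hloc ρ h1 h2 x h3).2]
  · simp only [hh, if_neg (show x ≠ 0 from hx.2)]
    ring

end
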